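/- arXiv:0706.1419 — 2 statements merged into one kernel-verified Lean document; each statement's English description precedes it below -/
import Mathlib

section
/- Let λ ∈ (0,1); let μ ≠ δ₀ be a symmetric Borel probability measure on ℝ that is ⊞_λ-infinitely divisible with rectangular R-transform C, and let ν, ρ be symmetric Borel probability measures on ℝ such that ρ is the rectangular free convolution μ ⊞_λ ν. Assume moreover that the limit of C(x)²/x as x → −∞ exists in [−∞, 0] and is nonzero. Then for every x ∈ (0,+∞), the limits lim_{z→x, z∈ℂ⁺} M_ρ(z) and lim_{z→x, z∈ℂ⁺} H_ρ(z) exist and are finite complex numbers. -/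
open MeasureTheory Complex Set Filter Topology

noncomputable section

/-- The upper half-plane. -/
def UHP : Set ℂ := {z : ℂ | 0 < z.im}

/-- The nonnegative real axis, viewed as a subset of `ℂ`. -/
def posAxis : Set ℂ := {z : ℂ | z.im = 0 ∧ 0 ≤ z.re}

/-- `M_μ(z) = ∫ z t² / (1 - z t²) dμ(t)`. -/
def Mt (μ : Measure ℝ) (z : ℂ) : ℂ := ∫ t : ℝ, z * (t : ℂ) ^ 2 / (1 - z * (t : ℂ) ^ 2) ∂μ

/-- `H_μ(z) = z (1 + M_μ(z)) (1 + λ M_μ(z))`. -/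
def Ht (l : ℝ) (μ : Measure ℝ) (z : ℂ) : ℂ :=
  z * (1 + Mt μ z) * (1 + (l : ℂ) * Mt μ z)

/-- `T(w) = (λ w + 1)(w + 1)`. -/
def Tfun (l : ℝ) (w : ℂ) : ℂ := ((l : ℂ) * w + 1) * (w + 1)

/-- The rectangular `R`-transform with Lévy measure `G`:
`C(z) = z ∫ (1+t²)/(1-z t²) dG(t)`. -/
def rectC (G : Measure ℝ) (z : ℂ) : ℂ :=
  z * ∫ t : ℝ, (1 + (t : ℂ) ^ 2) / (1 - z * (t : ℂ) ^ 2) ∂G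

/-- `μ` is `⊞_λ`-infinitely divisible with rectangular `R`-transform `C = rectC G`:
`H_μ(x) = x T(C(H_μ(x)))` for `x < 0` close to `0`. -/
def IsRectInfDiv (l : ℝ) (μ G : Measure ℝ) : Prop :=
  ∃ ε > (0 : ℝ), ∀ x ∈ Set.Ioo (-ε) (0 : ℝ),
    Ht l μ (x : ℂ) = (x : ℂ) * Tfun l (rectC G (Ht l μ (x : ℂ)))

/-- `ρ` is the rectangular free convolution `μ ⊞_λ ν`, where `μ` has rectangular
`R`-transform `rectC G`. -/
def IsRectConv (l : ℝ) (G ν ρ : Measure ℝ) : Prop :=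
  ∃ ε > (0 : ℝ), ∀ x ∈ Set.Ioo (-ε) (0 : ℝ),
    Tfun l (Mt ρ (x : ℂ) - rectC G (Ht l ρ (x : ℂ))) ≠ 0 ∧
    Ht l ρ (x : ℂ) =
      Ht l ν (Ht l ρ (x : ℂ) / Tfun l (Mt ρ (x : ℂ) - rectC G (Ht l ρ (x : ℂ))))

lemma den_im (u v : ℂ) (t : ℝ) : (u + (t:ℂ)^2 * v).im = u.im + t^2 * v.im := by
  have : ((t:ℂ)^2) = ((t^2 : ℝ) : ℂ) := by push_cast; rfl
  rw [this, add_im, im_ofReal_mul]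

lemma den_norm {u v : ℂ} {c : ℝ} (hu : c ≤ u.im) (hv : c ≤ v.im) (t : ℝ) :
    c * (1 + t^2) ≤ ‖u + (t:ℂ)^2 * v‖ := by
  have h := le_trans (le_abs_self _) (Complex.abs_im_le_norm (u + (t:ℂ)^2 * v))
  rw [den_im] at h
  nlinarith [sq_nonneg t, mul_le_mul_of_nonneg_left hv (sq_nonneg t)]

lemma den_ne {u v : ℂ} (hu : 0 < u.im) (hv : 0 < v.im) (t : ℝ) : u + (t:ℂ)^2 * v ≠ 0 := by
  intro h
  have := den_im u v t
  rw [h] at this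
  simp only [zero_im] at this
  nlinarith [mul_nonneg (sq_nonneg t) hv.le]

/-- Basic kernel integral. -/
def KK (φ : ℝ → ℝ) (τ : Measure ℝ) (q : ℂ × ℂ) : ℂ :=
  ∫ t : ℝ, -(φ t : ℂ) / (q.1 + (t:ℂ)^2 * q.2) ∂τ

/-- Admissible weights. -/
structure Adm (φ : ℝ → ℝ) : Prop where
  cont : Continuous φ
  pos : ∀ t, 0 < φ t
  le : ∀ t, φ t ≤ 1 + t^2

lemma adm_one : Adm (fun _ => 1) :=
  ⟨continuous_const, fun _ => one_pos, fun t => by nlinarith [sq_nonneg t]⟩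

lemma adm_sq : Adm (fun t => 1 + t^2) :=
  ⟨by fun_prop, fun t => by positivity, fun t => le_rfl⟩

variable {φ : ℝ → ℝ} {τ : Measure ℝ}

lemma KK_cont (hφ : Adm φ) {u v : ℂ} (hu : 0 < u.im) (hv : 0 < v.im) :
    Continuous (fun t : ℝ => -(φ t : ℂ) / (u + (t:ℂ)^2 * v)) := by
  have := hφ.cont
  exact Continuous.div (by fun_prop) (by fun_prop) (fun t => den_ne hu hv t)

lemma KK_bound (hφ : Adm φ) {u v : ℂ} {c : ℝ} (hc : 0 < c) (hu : c ≤ u.im) (hv : c ≤ v.im)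
    (t : ℝ) : ‖-(φ t : ℂ) / (u + (t:ℂ)^2 * v)‖ ≤ 1 / c := by
  have h1 := den_norm hu hv t
  have h2 : 0 < c * (1 + t^2) := by positivity
  rw [norm_div, norm_neg, Complex.norm_real, Real.norm_eq_abs, abs_of_pos (hφ.pos t),
    div_le_div_iff₀ (by linarith) hc]
  nlinarith [hφ.le t]

lemma KK_int [IsFiniteMeasure τ] (hφ : Adm φ) {u v : ℂ} (hu : 0 < u.im) (hv : 0 < v.im) :
    Integrable (fun t : ℝ => -(φ t : ℂ) / (u + (t:ℂ)^2 * v)) τ := by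
  refine Integrable.of_bound (C := 1 / min u.im v.im)
    (KK_cont hφ hu hv).aestronglyMeasurable (Eventually.of_forall fun t => ?_)
  exact KK_bound hφ (lt_min hu hv) (min_le_left _ _) (min_le_right _ _) t

lemma neg_div_im (a : ℝ) (d : ℂ) : (-(a:ℂ) / d).im = a * d.im / normSq d := by
  rw [div_eq_mul_inv, ← ofReal_neg, im_ofReal_mul, inv_im]; ring

lemma KK_im_eq [IsFiniteMeasure τ] (hφ : Adm φ) {u v : ℂ} (hu : 0 < u.im) (hv : 0 < v.im) :
    (KK φ τ (u, v)).im = ∫ t : ℝ, (-(φ t : ℂ) / (u + (t:ℂ)^2 * v)).im ∂τ := by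
  have := integral_im (𝕜 := ℂ) (KK_int (τ := τ) hφ hu hv)
  simpa [KK] using this.symm

lemma KK_im_pt (hφ : Adm φ) {u v : ℂ} (hu : 0 < u.im) (hv : 0 < v.im) (t : ℝ) :
    0 < (-(φ t : ℂ) / (u + (t:ℂ)^2 * v)).im := by
  rw [neg_div_im, den_im]
  have h := normSq_pos.2 (den_ne hu hv t)
  have := hφ.pos t
  have : 0 < u.im + t^2 * v.im := by nlinarith [mul_nonneg (sq_nonneg t) hv.le]
  positivity

lemma KK_im_nonneg [IsFiniteMeasure τ] (hφ : Adm φ) {u v : ℂ} (hu : 0 < u.im) (hv : 0 < v.im) :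
    0 ≤ (KK φ τ (u, v)).im := by
  rw [KK_im_eq hφ hu hv]
  exact integral_nonneg fun t => (KK_im_pt hφ hu hv t).le

lemma KK_im_pos [IsFiniteMeasure τ] (hτ : τ ≠ 0) (hφ : Adm φ) {u v : ℂ} (hu : 0 < u.im)
    (hv : 0 < v.im) : 0 < (KK φ τ (u, v)).im := by
  rw [KK_im_eq hφ hu hv, integral_pos_iff_support_of_nonneg]
  · have : Function.support (fun t : ℝ => (-(φ t : ℂ) / (u + (t:ℂ)^2 * v)).im) = univ := by
      ext t; simpa using (KK_im_pt hφ hu hv t).ne'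
    rw [this]
    exact (Measure.measure_univ_pos).2 hτ
  · exact fun t => (KK_im_pt hφ hu hv t).le
  · exact (KK_int hφ hu hv).im

lemma KK_norm_le [IsProbabilityMeasure τ] {u v : ℂ} (hu : 0 < u.im) (hv : 0 < v.im) :
    ‖KK (fun _ => 1) τ (u, v)‖ ≤ 1 / u.im := by
  unfold KK
  have := norm_integral_le_of_norm_le_const (μ := τ) (C := 1 / u.im)
    (f := fun t : ℝ => -(((fun _ => 1 : ℝ → ℝ) t : ℝ) : ℂ) / (u + (t:ℂ)^2 * v))
    (Eventually.of_forall fun t => ?_)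
  · simpa using this
  · have h := le_trans (le_abs_self _) (Complex.abs_im_le_norm (u + (t:ℂ)^2 * v))
    rw [den_im] at h
    rw [norm_div]
    simp only [ofReal_one, norm_neg, norm_one]
    apply one_div_le_one_div_of_le hu
    nlinarith [mul_nonneg (sq_nonneg t) hv.le]

/-- Hyperbolic closeness relation. -/
def Rl (c : ℝ) (u v : ℂ) : Prop := ∀ s > (0:ℝ), 2 * ‖u - v‖ ≤ c * (s * u.im + v.im / s)

lemma Rl.add {c : ℝ} {u v u' v' : ℂ} (h : Rl c u v) (h' : Rl c u' v') :
    Rl c (u + u') (v + v') := by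
  intro s hs
  have e : u + u' - (v + v') = (u - v) + (u' - v') := by ring
  have := norm_add_le (u - v) (u' - v')
  rw [e, add_im, add_im]
  have h1 := h s hs
  have h2 := h' s hs
  have : c * (s * (u.im + u'.im) + (v.im + v'.im) / s)
    = c * (s * u.im + v.im / s) + c * (s * u'.im + v'.im / s) := by ring
  linarith

lemma Rl.smul {c : ℝ} {u v : ℂ} (h : Rl c u v) {a : ℝ} (ha : 0 ≤ a) :
    Rl c ((a:ℂ) * u) ((a:ℂ) * v) := by
  intro s hs
  have h1 := mul_le_mul_of_nonneg_left (h s hs) ha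
  rw [← mul_sub, norm_mul, Complex.norm_real, Real.norm_eq_abs, abs_of_nonneg ha,
    im_ofReal_mul, im_ofReal_mul]
  have : c * (s * (a * u.im) + a * v.im / s) = a * (c * (s * u.im + v.im / s)) := by ring
  linarith

lemma Rl.refl {c : ℝ} (hc : 0 ≤ c) {u : ℂ} (hu : 0 ≤ u.im) : Rl c u u := by
  intro s hs
  simp only [sub_self, norm_zero, mul_zero]
  positivity

lemma ninv_im (u : ℂ) : (-1 / u).im = u.im / ‖u‖^2 := by
  have := neg_div_im 1 u
  rw [ofReal_one, normSq_eq_norm_sq] at this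
  rw [this]; ring

lemma ninv_im_pos {u : ℂ} (hu : 0 < u.im) : 0 < (-1 / u).im := by
  have : u ≠ 0 := by rintro rfl; simp at hu
  rw [ninv_im]; positivity

lemma ninv_im_nonneg {u : ℂ} (hu : 0 ≤ u.im) : 0 ≤ (-1 / u).im := by
  rw [ninv_im]; positivity

lemma Rl.ninv {c : ℝ} {u v : ℂ} (h : Rl c u v) (hu : 0 < u.im) (hv : 0 < v.im) :
    Rl c (-1 / u) (-1 / v) := by
  intro s hs
  have hu0 : u ≠ 0 := by rintro rfl; simp at hu
  have hv0 : v ≠ 0 := by rintro rfl; simp at hv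
  have nu : 0 < ‖u‖ := norm_pos_iff.2 hu0
  have nv : 0 < ‖v‖ := norm_pos_iff.2 hv0
  have e : -1 / u - -1 / v = (u - v) / (u * v) := by field_simp; ring
  rw [e, norm_div, norm_mul, ninv_im, ninv_im]
  have h1 := h (s * ‖v‖ / ‖u‖) (by positivity)
  have h2 := div_le_div_of_nonneg_right h1 (mul_pos nu nv).le
  calc 2 * (‖u - v‖ / (‖u‖ * ‖v‖)) = 2 * ‖u - v‖ / (‖u‖ * ‖v‖) := by ring
    _ ≤ _ := h2
    _ = _ := by field_simp

lemma Rl.KK [IsFiniteMeasure τ] (hφ : Adm φ) {c : ℝ} {u v u' v' : ℂ}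
    (h : Rl c u u') (h' : Rl c v v')
    (hu : 0 < u.im) (hv : 0 < v.im) (hu' : 0 < u'.im) (hv' : 0 < v'.im) :
    Rl c (KK φ τ (u, v)) (KK φ τ (u', v')) := by
  have key : ∀ t : ℝ, Rl c (-(φ t : ℂ) / (u + (t:ℂ)^2 * v)) (-(φ t : ℂ) / (u' + (t:ℂ)^2 * v')) := by
    intro t
    have e : ((t:ℂ)^2) = ((t^2 : ℝ) : ℂ) := by push_cast; rfl
    have p1 : 0 < (u + (t:ℂ)^2 * v).im := by
      rw [den_im]; nlinarith [mul_nonneg (sq_nonneg t) hv.le]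
    have p2 : 0 < (u' + (t:ℂ)^2 * v').im := by
      rw [den_im]; nlinarith [mul_nonneg (sq_nonneg t) hv'.le]
    have r : Rl c (u + (t:ℂ)^2 * v) (u' + (t:ℂ)^2 * v') := by
      rw [e]; exact h.add (h'.smul (sq_nonneg t))
    have := (r.ninv p1 p2).smul (hφ.pos t).le
    have e2 : ∀ d : ℂ, (φ t : ℂ) * (-1 / d) = -(φ t : ℂ) / d := fun d => by ring
    rwa [e2, e2] at this
  intro s hs
  rw [KK_im_eq hφ hu hv, KK_im_eq hφ hu' hv']
  have i1 := KK_int (τ := τ) hφ hu hv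
  have i2 := KK_int (τ := τ) hφ hu' hv'
  have j1 : Integrable (fun t : ℝ => (-(φ t : ℂ) / (u + (t:ℂ)^2 * v)).im) τ := i1.im
  have j2 : Integrable (fun t : ℝ => (-(φ t : ℂ) / (u' + (t:ℂ)^2 * v')).im) τ := i2.im
  have hn : ‖_root_.KK φ τ (u, v) - _root_.KK φ τ (u', v')‖ ≤
      ∫ t : ℝ, ‖-(φ t : ℂ) / (u + (t:ℂ)^2 * v) - -(φ t : ℂ) / (u' + (t:ℂ)^2 * v')‖ ∂τ := by
    unfold _root_.KK
    rw [← integral_sub i1 i2]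
    exact norm_integral_le_integral_norm _
  have hm := integral_mono ((i1.sub i2).norm.const_mul 2)
    (((j1.const_mul s).add (j2.div_const s)).const_mul c) (fun t => key t s hs)
  simp only [Pi.add_apply, Pi.sub_apply] at hm
  rw [integral_const_mul, integral_const_mul, integral_add (j1.const_mul s) (j2.div_const s),
    integral_const_mul, integral_div] at hm
  linarith

lemma KK_diff [IsFiniteMeasure τ] (hφ : Adm φ) {q : ℂ × ℂ} (hu : 0 < q.1.im) (hv : 0 < q.2.im) :
    DifferentiableAt ℂ (KK φ τ) q := by
  set c := min q.1.im q.2.im / 2 with hc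
  have hmin : 0 < min q.1.im q.2.im := lt_min hu hv
  have hc0 : 0 < c := by positivity
  let s : Set (ℂ × ℂ) := {r | c < r.1.im ∧ c < r.2.im}
  have hs : s ∈ 𝓝 q := by
    apply IsOpen.mem_nhds
    · have o1 : IsOpen {r : ℂ × ℂ | c < r.1.im} :=
        isOpen_lt continuous_const (Complex.continuous_im.comp continuous_fst)
      have o2 : IsOpen {r : ℂ × ℂ | c < r.2.im} :=
        isOpen_lt continuous_const (Complex.continuous_im.comp continuous_snd)
      exact o1.inter o2
    · constructor
      · have := min_le_left q.1.im q.2.im; linarith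
      · have := min_le_right q.1.im q.2.im; linarith
  let F' : ℂ × ℂ → ℝ → (ℂ × ℂ →L[ℂ] ℂ) := fun r t =>
    ((φ t : ℂ) / (r.1 + (t:ℂ)^2 * r.2)^2) •
      (ContinuousLinearMap.fst ℂ ℂ ℂ + ((t:ℂ)^2) • ContinuousLinearMap.snd ℂ ℂ ℂ)
  have := hasFDerivAt_integral_of_dominated_of_fderiv_le (μ := τ) (𝕜 := ℂ) (s := s) (x₀ := q)
    (F := fun r t => -(φ t : ℂ) / (r.1 + (t:ℂ)^2 * r.2)) (F' := F')
    (bound := fun _ => 1 / c^2) hs ?_ (KK_int hφ hu hv) ?_ ?_ (integrable_const _) ?_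
  · exact this.differentiableAt
  · filter_upwards [hs] with r hr
    exact (KK_cont hφ (hc0.trans hr.1) (hc0.trans hr.2)).aestronglyMeasurable
  · apply Continuous.aestronglyMeasurable
    have := hφ.cont
    refine Continuous.smul (Continuous.div (by fun_prop) (by fun_prop)
      (fun t => pow_ne_zero _ (den_ne hu hv t))) ?_
    fun_prop
  · refine Eventually.of_forall fun t r hr => ?_
    have hd := den_norm hr.1.le hr.2.le t
    have hd0 : 0 < c * (1 + t^2) := by positivity
    have n1 : ‖ContinuousLinearMap.fst ℂ ℂ ℂ + ((t:ℂ)^2) • ContinuousLinearMap.snd ℂ ℂ ℂ‖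
        ≤ 1 + t^2 := by
      refine (norm_add_le _ _).trans (add_le_add (ContinuousLinearMap.norm_fst_le _ _ _) ?_)
      rw [norm_smul]
      have : ‖(t:ℂ)^2‖ = t^2 := by simp
      rw [this]
      have := ContinuousLinearMap.norm_snd_le ℂ ℂ ℂ
      nlinarith [sq_nonneg t]
    have n2 : ‖(φ t : ℂ) / (r.1 + (t:ℂ)^2 * r.2)^2‖ ≤ (1 + t^2) / (c * (1 + t^2))^2 := by
      rw [norm_div, norm_pow, Complex.norm_real, Real.norm_eq_abs, abs_of_pos (hφ.pos t)]
      have := hφ.le t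
      gcongr
    rw [norm_smul]
    calc _ ≤ (1 + t^2) / (c * (1 + t^2))^2 * (1 + t^2) := by gcongr
      _ = 1 / c^2 := by field_simp
  · refine Eventually.of_forall fun t r hr => ?_
    have hne := den_ne (hc0.trans hr.1) (hc0.trans hr.2) t
    have h1 : HasFDerivAt (fun r : ℂ × ℂ => r.1 + (t:ℂ)^2 * r.2)
      (ContinuousLinearMap.fst ℂ ℂ ℂ + ((t:ℂ)^2) • ContinuousLinearMap.snd ℂ ℂ ℂ) r :=
      (hasFDerivAt_fst).add ((hasFDerivAt_snd).const_mul _)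
    have h2 : HasDerivAt (fun d : ℂ => -(φ t : ℂ) / d)
        ((φ t : ℂ) / (r.1 + (t:ℂ)^2 * r.2)^2) (r.1 + (t:ℂ)^2 * r.2) := by
      have := (hasDerivAt_inv hne).const_mul (-(φ t : ℂ))
      have e : -(φ t : ℂ) * -((r.1 + (t:ℂ)^2 * r.2)^2)⁻¹ = (φ t : ℂ) / (r.1 + (t:ℂ)^2 * r.2)^2 := by
        ring
      rw [e] at this
      exact this
    exact h2.comp_hasFDerivAt r h1


lemma geodesic_fixed {F : ℂ → ℂ} (hF : ∀ p : ℂ, 0 < p.im → 0 < (F p).im) {a a' : ℂ}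
    (ha : ∀ p : ℂ, 0 < p.im → ‖F p - a‖^2 * p.im ≤ ‖p - a‖^2 * (F p).im)
    (ha' : ∀ p : ℂ, 0 < p.im → ‖F p - a'‖^2 * p.im ≤ ‖p - a'‖^2 * (F p).im)
    {s : ℝ} (hs : s ∈ Ioo (0:ℝ) 1) {U P : ℝ} (hU : U = s * a.re + (1 - s) * a'.re) (hP : 0 < P)
    (hW : P^2 = s * (a.re^2 + a.im^2) + (1 - s) * (a'.re^2 + a'.im^2) - U^2) :
    F ⟨U, P⟩ = ⟨U, P⟩ := by
  have h1 := ha ⟨U, P⟩ hP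
  have h2 := ha' ⟨U, P⟩ hP
  have hQ := hF ⟨U, P⟩ hP
  set q := F ⟨U, P⟩ with hq
  simp only [← normSq_eq_norm_sq, normSq_apply, sub_re, sub_im] at h1 h2
  obtain ⟨hs0, hs1⟩ := hs
  have h3 := add_le_add (mul_le_mul_of_nonneg_left h1 hs0.le)
    (mul_le_mul_of_nonneg_left h2 (by linarith : (0:ℝ) ≤ 1 - s))
  set V := s * a.im + (1 - s) * a'.im with hV
  have h4 : ((q.re - U)^2 + q.im^2 + P^2 - 2 * q.im * V) * P ≤ (2 * P^2 - 2 * P * V) * q.im := by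
    have e1 : s * (((q.re - a.re) * (q.re - a.re) + (q.im - a.im) * (q.im - a.im)) * P) +
      (1 - s) * (((q.re - a'.re) * (q.re - a'.re) + (q.im - a'.im) * (q.im - a'.im)) * P) =
      ((q.re - U)^2 + q.im^2 + P^2 - 2 * q.im * V) * P := by
      rw [hW, hV, hU]; ring
    have e2 : s * (((U - a.re) * (U - a.re) + (P - a.im) * (P - a.im)) * q.im) +
      (1 - s) * (((U - a'.re) * (U - a'.re) + (P - a'.im) * (P - a'.im)) * q.im) =
      (2 * P^2 - 2 * P * V) * q.im := by
      rw [hV]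
      linear_combination (-q.im) * hW + (2 * U * q.im) * hU
    rw [e1, e2] at h3
    exact h3
  have h5 : ((q.re - U)^2 + (q.im - P)^2) * P ≤ 0 := by linarith
  have h6 : (q.re - U)^2 + (q.im - P)^2 ≤ 0 := by
    by_contra hcon
    push Not at hcon
    nlinarith [mul_pos hcon hP]
  have n1 := sq_nonneg (q.re - U)
  have n2 := sq_nonneg (q.im - P)
  have h7 : q.re = U := sub_eq_zero.1 (pow_eq_zero_iff two_ne_zero |>.1 (by linarith))
  have h8 : q.im = P := sub_eq_zero.1 (pow_eq_zero_iff two_ne_zero |>.1 (by linarith))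
  exact Complex.ext h7 h8

lemma UHP_open : IsOpen UHP := isOpen_lt continuous_const Complex.continuous_im

lemma UHP_conv : IsPreconnected UHP := (convex_halfSpace_im_gt 0).isPreconnected

lemma eq_id_of_two {F : ℂ → ℂ} (hF : ∀ p : ℂ, 0 < p.im → 0 < (F p).im)
    (hd : DifferentiableOn ℂ F UHP) {a a' : ℂ} (ia : 0 ≤ a.im) (ia' : 0 ≤ a'.im) (hne : a ≠ a')
    (ha : ∀ p : ℂ, 0 < p.im → ‖F p - a‖^2 * p.im ≤ ‖p - a‖^2 * (F p).im)
    (ha' : ∀ p : ℂ, 0 < p.im → ‖F p - a'‖^2 * p.im ≤ ‖p - a'‖^2 * (F p).im) :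
    ∀ p : ℂ, 0 < p.im → F p = p := by
  let U : ℝ → ℝ := fun s => s * a.re + (1 - s) * a'.re
  let W : ℝ → ℝ := fun s => s * (a.re^2 + a.im^2) + (1 - s) * (a'.re^2 + a'.im^2) - (U s)^2
  have hWpos : ∀ s ∈ Ioo (0:ℝ) 1, 0 < W s := by
    rintro s ⟨h0, h1⟩
    have e : W s = s * (1 - s) * (a.re - a'.re)^2 + s * a.im^2 + (1 - s) * a'.im^2 := by
      simp only [W, U]; ring
    rw [e]
    have h2 : 0 < 1 - s := by linarith
    by_cases hr : a.re = a'.re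
    · have hi : a.im ≠ a'.im := fun h => hne (Complex.ext hr h)
      rcases ia.lt_or_eq with h | h
      · have : 0 < s * a.im^2 := by positivity
        have : 0 ≤ s * (1 - s) * (a.re - a'.re)^2 := by positivity
        have : 0 ≤ (1 - s) * a'.im^2 := by positivity
        linarith
      · have h' : 0 < a'.im := lt_of_le_of_ne ia' (by rw [← h] at hi; exact hi)
        have : 0 < (1 - s) * a'.im^2 := by positivity
        have : 0 ≤ s * (1 - s) * (a.re - a'.re)^2 := by positivity
        have : 0 ≤ s * a.im^2 := by positivity
        linarith
    · have : 0 < (a.re - a'.re)^2 := by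
        have := sub_ne_zero.2 hr
        positivity
      have : 0 < s * (1 - s) * (a.re - a'.re)^2 := by positivity
      have : 0 ≤ (1 - s) * a'.im^2 := by positivity
      have : 0 ≤ s * a.im^2 := by positivity
      linarith
  let γ : ℝ → ℂ := fun s => ⟨U s, Real.sqrt (W s)⟩
  have hγfix : ∀ s ∈ Ioo (0:ℝ) 1, F (γ s) = γ s := fun s hs =>
    geodesic_fixed hF ha ha' hs rfl (Real.sqrt_pos.2 (hWpos s hs)) (Real.sq_sqrt (hWpos s hs).le)
  have hγinj : ∀ s ∈ Ioo (0:ℝ) 1, ∀ s' ∈ Ioo (0:ℝ) 1, γ s = γ s' → s = s' := by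
    intro s hs s' hs' h
    have h1 : U s = U s' := congrArg Complex.re h
    have h2 : W s = W s' := by
      have h3 : Real.sqrt (W s) = Real.sqrt (W s') := congrArg Complex.im h
      exact (Real.sqrt_inj (hWpos s hs).le (hWpos s' hs').le).1 h3
    have h1' : (s - s') * (a.re - a'.re) = 0 := by simp only [U] at h1; linarith
    rcases mul_eq_zero.1 h1' with h | hr
    · linarith
    · have hr' : a.re = a'.re := by linarith
      have hi : a.im ≠ a'.im := fun h => hne (Complex.ext hr' h)
      have h2' : (s - s') * ((a.im - a'.im) * (a.im + a'.im)) = 0 := by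
        simp only [W] at h2
        rw [h1, hr'] at h2
        linarith
      rcases mul_eq_zero.1 h2' with h | h
      · linarith
      · rcases mul_eq_zero.1 h with h | h
        · exact absurd (by linarith) hi
        · exact absurd (by linarith) hi
  have hγc : Continuous γ := by
    have : γ = fun s => ((U s : ℝ) : ℂ) + ((Real.sqrt (W s) : ℝ) : ℂ) * I := by
      ext s
      exact (Complex.mk_eq_add_mul_I _ _)
    rw [this]
    have hUc : Continuous U := by fun_prop
    have hWc : Continuous W := by fun_prop
    fun_prop
  have half : (1/2 : ℝ) ∈ Ioo (0:ℝ) 1 := by norm_num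
  have han : AnalyticOnNhd ℂ (fun p => F p - p) UHP :=
    (hd.sub differentiableOn_id).analyticOnNhd UHP_open
  have hz := han.eqOn_zero_of_preconnected_of_frequently_eq_zero UHP_conv
    (z₀ := γ (1/2)) (Real.sqrt_pos.2 (hWpos _ half)) ?_
  · intro p hp
    have := hz hp
    simpa [sub_eq_zero] using this
  · have ht : Tendsto γ (𝓝[≠] (1/2)) (𝓝[≠] (γ (1/2))) := by
      refine tendsto_nhdsWithin_of_tendsto_nhds_of_eventually_within _
        (hγc.continuousAt.tendsto.mono_left nhdsWithin_le_nhds) ?_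
      filter_upwards [self_mem_nhdsWithin,
        mem_nhdsWithin_of_mem_nhds (isOpen_Ioo.mem_nhds half)] with s h1 h2
      exact fun h => h1 (hγinj s h2 _ half h)
    refine ht.frequently (Eventually.frequently ?_)
    filter_upwards [mem_nhdsWithin_of_mem_nhds (isOpen_Ioo.mem_nhds half)] with s h2
    rw [hγfix s h2, sub_self]

lemma abstract_limit {l : Filter ℂ} [l.NeBot] {g : ℂ → ℂ} {Fb : ℂ → ℂ → ℂ} {F : ℂ → ℂ}
    (hlim : ∀ p : ℂ, 0 < p.im → Tendsto (fun b => Fb b p) l (𝓝 (F p)))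
    (hg : ∀ᶠ b in l, 0 < (g b).im)
    (hc : ∀ p : ℂ, 0 < p.im →
      ∀ᶠ b in l, ‖Fb b p - g b‖^2 * p.im ≤ ‖p - g b‖^2 * (Fb b p).im)
    (hF : ∀ p : ℂ, 0 < p.im → 0 < (F p).im)
    (hd : DifferentiableOn ℂ F UHP)
    {B : ℝ} (hB : ∀ᶠ y : ℝ in atTop, ∃ p : ℂ, p.im = y ∧ ‖F p‖ ≤ B) :
    ∃ L, Tendsto g l (𝓝 L) := by
  obtain ⟨y, ⟨p, hpy, hpB⟩, hyB, hy0⟩ :=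
    (hB.and ((eventually_gt_atTop B).and (eventually_gt_atTop 0))).exists
  have hp : 0 < p.im := by rw [hpy]; exact hy0
  have hFp : (F p).im < p.im := by
    have := le_trans (le_abs_self _) (Complex.abs_im_le_norm (F p))
    linarith
  have hnotid : ¬ ∀ p : ℂ, 0 < p.im → F p = p := by
    intro h
    have := h p hp
    rw [this] at hFp
    exact lt_irrefl _ hFp
  obtain ⟨Q, hQ1, hQ2⟩ := exists_between hFp
  have hQ0 : 0 < Q := (hF p hp).trans hQ1
  have hbd : ∃ R : ℝ, ∀ᶠ b in l, ‖g b‖ ≤ R := by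
    set C := ‖F p‖ + 1 with hC
    refine ⟨(Real.sqrt p.im * C + Real.sqrt Q * ‖p‖) / (Real.sqrt p.im - Real.sqrt Q), ?_⟩
    have e1 : ∀ᶠ b in l, (Fb b p).im < Q :=
      ((Complex.continuous_im.tendsto _).comp (hlim p hp)).eventually_lt_const hQ1
    have e2 : ∀ᶠ b in l, ‖Fb b p‖ < C :=
      ((hlim p hp).norm).eventually_lt_const (by linarith)
    filter_upwards [e1, e2, hc p hp] with b h1 h2 h3
    have hs : Real.sqrt Q < Real.sqrt p.im := Real.sqrt_lt_sqrt hQ0.le hQ2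
    rw [le_div_iff₀ (by linarith)]
    have h4 : (‖Fb b p - g b‖ * Real.sqrt p.im)^2 ≤ (‖p - g b‖ * Real.sqrt Q)^2 := by
      rw [mul_pow, mul_pow, Real.sq_sqrt hp.le, Real.sq_sqrt hQ0.le]
      exact h3.trans (mul_le_mul_of_nonneg_left h1.le (by positivity))
    have h5 := abs_le_of_sq_le_sq h4 (by positivity)
    have h5 := (le_abs_self _).trans h5
    have h6 : ‖g b‖ - C ≤ ‖Fb b p - g b‖ := by
      have := norm_sub_norm_le (g b) (Fb b p)
      rw [norm_sub_rev] at this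
      linarith
    have h7 : ‖p - g b‖ ≤ ‖p‖ + ‖g b‖ := norm_sub_le _ _
    have h8 := mul_le_mul_of_nonneg_right h6 (Real.sqrt_nonneg p.im)
    have h9 := mul_le_mul_of_nonneg_right h7 (Real.sqrt_nonneg Q)
    nlinarith
  obtain ⟨R, hR⟩ := hbd
  have hcl : ∀ a : ℂ, ClusterPt a (map g l) → 0 ≤ a.im ∧
      ∀ p : ℂ, 0 < p.im → ‖F p - a‖^2 * p.im ≤ ‖p - a‖^2 * (F p).im := by
    intro a h
    have hmc : MapClusterPt a l g := h
    obtain ⟨u, hu, hua⟩ := mapClusterPt_iff_ultrafilter.1 hmc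
    refine ⟨?_, fun p hp => ?_⟩
    · exact ge_of_tendsto ((Complex.continuous_im.tendsto _).comp hua)
        ((hg.filter_mono hu).mono fun b hb => le_of_lt hb)
    · have t1 := (hlim p hp).mono_left hu
      refine le_of_tendsto_of_tendsto (((t1.sub hua).norm.pow 2).mul_const _)
        ((((tendsto_const_nhds (x := p)).sub hua).norm.pow 2).mul
          ((Complex.continuous_im.tendsto _).comp t1)) ((hc p hp).filter_mono hu)
  have hcomp : IsCompact (Metric.closedBall (0:ℂ) R) := isCompact_closedBall _ _
  have hmem : Metric.closedBall (0:ℂ) R ∈ map g l := by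
    rw [mem_map]
    filter_upwards [hR] with b hb
    simpa using hb
  obtain ⟨L, hLm, hL⟩ := hcomp (f := map g l) (le_principal_iff.2 hmem)
  refine ⟨L, hcomp.le_nhds_of_unique_clusterPt hmem fun a _ ha => ?_⟩
  by_contra hne
  exact hnotid (eq_id_of_two hF hd (hcl a ha).1 (hcl L hL).1 hne (hcl a ha).2 (hcl L hL).2)


/-- second component -/
def PP (l : ℝ) (b p : ℂ) : ℂ := (l:ℂ) * p + ((1 - l : ℝ) : ℂ) * (-1 / b)

/-- first subordination function -/
def WA (l : ℝ) (G : Measure ℝ) (b p : ℂ) : ℂ :=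
  b + KK (fun t => 1 + t^2) G (-1 / PP l b p, p)

/-- second subordination function -/
def WB (l : ℝ) (G : Measure ℝ) (b p : ℂ) : ℂ :=
  b + (l:ℂ) * KK (fun t => 1 + t^2) G (-1 / p, PP l b p)

/-- self-map of the upper half-plane -/
def FF (l : ℝ) (G ν : Measure ℝ) (b p : ℂ) : ℂ :=
  KK (fun _ => 1) ν (WA l G b p, -1 / WB l G b p)

section
variable {l : ℝ} {G ν : Measure ℝ} [IsFiniteMeasure G] [IsProbabilityMeasure ν]

lemma PP_pos (hl : l ∈ Ioo (0:ℝ) 1) {b p : ℂ} (hb : 0 ≤ b.im) (hp : 0 < p.im) :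
    0 < (PP l b p).im := by
  have h1 := ninv_im_nonneg hb
  have h2 : 0 < 1 - l := by linarith [hl.2]
  have h3 := hl.1
  rw [PP, add_im, im_ofReal_mul, im_ofReal_mul]
  positivity

lemma WA_pos (hl : l ∈ Ioo (0:ℝ) 1) (hG : G ≠ 0) {b p : ℂ} (hb : 0 ≤ b.im) (hp : 0 < p.im) :
    0 < (WA l G b p).im := by
  rw [WA, add_im]
  have := KK_im_pos hG adm_sq (ninv_im_pos (PP_pos hl hb hp)) hp
  linarith

lemma WB_pos (hl : l ∈ Ioo (0:ℝ) 1) (hG : G ≠ 0) {b p : ℂ} (hb : 0 ≤ b.im) (hp : 0 < p.im) :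
    0 < (WB l G b p).im := by
  rw [WB, add_im, im_ofReal_mul]
  have := mul_pos hl.1 (KK_im_pos hG adm_sq (ninv_im_pos hp) (PP_pos hl hb hp))
  linarith

lemma FF_pos (hl : l ∈ Ioo (0:ℝ) 1) (hG : G ≠ 0) {b p : ℂ} (hb : 0 ≤ b.im) (hp : 0 < p.im) :
    0 < (FF l G ν b p).im :=
  KK_im_pos (IsProbabilityMeasure.ne_zero ν) adm_one (WA_pos hl hG hb hp)
    (ninv_im_pos (WB_pos hl hG hb hp))

lemma FF_Rl (hl : l ∈ Ioo (0:ℝ) 1) (hG : G ≠ 0) {b p g : ℂ} (hb : 0 ≤ b.im) (hp : 0 < p.im)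
    (hg : 0 < g.im) {c : ℝ} (hc : 0 ≤ c) (h : Rl c p g) :
    Rl c (FF l G ν b p) (FF l G ν b g) := by
  have h2 : Rl c (PP l b p) (PP l b g) :=
    (h.smul hl.1.le).add ((Rl.refl hc (ninv_im_nonneg hb)).smul (by linarith [hl.2]))
  have pp := PP_pos hl hb hp
  have pg := PP_pos hl hb hg
  have hA : Rl c (WA l G b p) (WA l G b g) :=
    (Rl.refl hc hb).add (Rl.KK adm_sq (h2.ninv pp pg) h (ninv_im_pos pp) hp (ninv_im_pos pg) hg)
  have hBB : Rl c (WB l G b p) (WB l G b g) :=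
    (Rl.refl hc hb).add
      ((Rl.KK adm_sq (h.ninv hp hg) h2 (ninv_im_pos hp) pp (ninv_im_pos hg) pg).smul hl.1.le)
  have wp := WB_pos (G := G) hl hG hb hp
  have wg := WB_pos (G := G) hl hG hb hg
  exact Rl.KK adm_one hA (hBB.ninv wp wg) (WA_pos hl hG hb hp) (ninv_im_pos wp)
    (WA_pos hl hG hb hg) (ninv_im_pos wg)

lemma FF_contr (hl : l ∈ Ioo (0:ℝ) 1) (hG : G ≠ 0) {b p g : ℂ} (hb : 0 ≤ b.im) (hp : 0 < p.im)
    (hg : 0 < g.im) (hfix : FF l G ν b g = g) :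
    ‖FF l G ν b p - g‖^2 * p.im ≤ ‖p - g‖^2 * (FF l G ν b p).im := by
  set sp := Real.sqrt p.im with hsp
  set sg := Real.sqrt g.im with hsg
  have sp0 : 0 < sp := Real.sqrt_pos.2 hp
  have sg0 : 0 < sg := Real.sqrt_pos.2 hg
  have sp2 : sp^2 = p.im := Real.sq_sqrt hp.le
  have sg2 : sg^2 = g.im := Real.sq_sqrt hg.le
  have h0 : Rl (‖p - g‖ / (sp * sg)) p g := by
    intro s hs
    rw [← sp2, ← sg2, div_mul_eq_mul_div, le_div_iff₀ (by positivity)]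
    have : 2 * (sp * sg) ≤ s * sp^2 + sg^2 / s := by
      have e : s * sp^2 + sg^2 / s - 2 * (sp * sg) = (s * sp - sg)^2 / s := by
        field_simp; ring
      have : 0 ≤ (s * sp - sg)^2 / s := by positivity
      linarith
    have := mul_le_mul_of_nonneg_left this (norm_nonneg (p - g))
    linarith
  have h1 := FF_Rl (ν := ν) hl hG hb hp hg (by positivity) h0
  rw [hfix] at h1
  have hF := FF_pos (ν := ν) hl hG hb hp
  set q := FF l G ν b p with hq
  set sq := Real.sqrt q.im with hsq
  have sq0 : 0 < sq := Real.sqrt_pos.2 hF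
  have sq2 : sq^2 = q.im := Real.sq_sqrt hF.le
  have h2 := h1 (sg / sq) (by positivity)
  rw [← sq2, ← sg2] at h2
  have h3 : ‖q - g‖ * sp ≤ ‖p - g‖ * sq := by
    have e : ‖p - g‖ / (sp * sg) * (sg / sq * sq^2 + sg^2 / (sg / sq)) = 2 * (‖p - g‖ * sq / sp) := by
      field_simp; ring
    rw [e] at h2
    have : ‖q - g‖ ≤ ‖p - g‖ * sq / sp := by linarith
    rwa [le_div_iff₀ sp0] at this
  have h4 := pow_le_pow_left₀ (by positivity) h3 2
  rw [mul_pow, mul_pow, sp2, sq2] at h4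
  exact h4

lemma dninv {E : Type*} [NormedAddCommGroup E] [NormedSpace ℂ E] {f : E → ℂ} {x : E}
    (hf : DifferentiableAt ℂ f x) (h : f x ≠ 0) : DifferentiableAt ℂ (fun y => -1 / f y) x := by
  have := (hf.inv h).const_mul (-1)
  simpa [div_eq_mul_inv] using this

lemma FF_diff (hl : l ∈ Ioo (0:ℝ) 1) (hG : G ≠ 0) {b p : ℂ} (hb : 0 ≤ b.im) (hb0 : b ≠ 0)
    (hp : 0 < p.im) : DifferentiableAt ℂ (fun q : ℂ × ℂ => FF l G ν q.1 q.2) (b, p) := by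
  have np := PP_pos hl hb hp
  have ne0 : ∀ {u : ℂ}, 0 < u.im → u ≠ 0 := by rintro u hu rfl; simp at hu
  have d1 : DifferentiableAt ℂ (fun q : ℂ × ℂ => PP l q.1 q.2) (b, p) := by
    unfold PP
    exact (differentiableAt_snd.const_mul _).add
      ((dninv (f := fun q : ℂ × ℂ => q.1) differentiableAt_fst hb0).const_mul _)
  have dA : DifferentiableAt ℂ (fun q : ℂ × ℂ => WA l G q.1 q.2) (b, p) := by
    unfold WA
    refine differentiableAt_fst.add ?_
    exact DifferentiableAt.comp (g := KK (fun t => 1 + t^2) G)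
      (f := fun q : ℂ × ℂ => (-1 / PP l q.1 q.2, q.2)) (b, p)
      (KK_diff adm_sq (ninv_im_pos np) hp)
      ((dninv d1 (ne0 np)).prodMk differentiableAt_snd)
  have dB : DifferentiableAt ℂ (fun q : ℂ × ℂ => WB l G q.1 q.2) (b, p) := by
    unfold WB
    refine differentiableAt_fst.add (DifferentiableAt.const_mul ?_ _)
    exact DifferentiableAt.comp (g := KK (fun t => 1 + t^2) G)
      (f := fun q : ℂ × ℂ => (-1 / q.2, PP l q.1 q.2)) (b, p)
      (KK_diff adm_sq (ninv_im_pos hp) np)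
      ((dninv (f := fun q : ℂ × ℂ => q.2) differentiableAt_snd (ne0 hp)).prodMk d1)
  have wb := WB_pos (G := G) hl hG hb hp
  unfold FF
  exact DifferentiableAt.comp (g := KK (fun _ => 1) ν)
      (f := fun q : ℂ × ℂ => (WA l G q.1 q.2, -1 / WB l G q.1 q.2)) (b, p)
      (KK_diff adm_one (WA_pos hl hG hb hp) (ninv_im_pos wb))
      (dA.prodMk (dninv dB (ne0 wb)))

end

lemma ne0_of_im {u : ℂ} (hu : 0 < u.im) : u ≠ 0 := by rintro rfl; simp at hu

lemma Mt_eq_KK {τ : Measure ℝ} [IsProbabilityMeasure τ] {u w : ℂ} (hu : 0 < u.im) (hw : 0 < w.im) :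
    Mt τ (1 / (u * w)) = -u * KK (fun _ => 1) τ (u, -1 / w) - 1 := by
  have hi := KK_int (τ := τ) adm_one hu (ninv_im_pos hw)
  have e : ∀ t : ℝ, 1 / (u * w) * (t:ℂ)^2 / (1 - 1 / (u * w) * (t:ℂ)^2) =
      -u * (-((1:ℝ) : ℂ) / (u + (t:ℂ)^2 * (-1 / w))) - 1 := by
    intro t
    have h1 := den_ne hu (ninv_im_pos hw) t
    have hu0 := ne0_of_im hu
    have hw0 := ne0_of_im hw
    have h2 : 1 - 1 / (u * w) * (t:ℂ)^2 = (u + (t:ℂ)^2 * (-1 / w)) / u := by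
      field_simp; ring
    rw [h2]
    have h3 : 1 / (u * w) * (t:ℂ)^2 = 1 - (u + (t:ℂ)^2 * (-1 / w)) / u := by
      rw [← h2]; ring
    rw [h3]
    generalize u + (t:ℂ)^2 * (-1 / w) = d at h1
    push_cast
    field_simp
  unfold Mt KK
  simp_rw [e]
  rw [integral_sub (hi.const_mul _) (integrable_const _), integral_const_mul]
  simp

lemma rectC_eq_KK {G : Measure ℝ} {p r : ℂ} (hp : 0 < p.im) (hr : 0 < r.im) :
    rectC G (p * r) = p * KK (fun t => 1 + t^2) G (-1 / r, p) := by
  unfold rectC KK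
  rw [mul_assoc, ← integral_const_mul]
  congr 2
  ext t
  have h1 := den_ne (ninv_im_pos hr) hp t
  have hr0 := ne0_of_im hr
  have h2 : 1 - p * r * (t:ℂ)^2 = -r * (-1 / r + (t:ℂ)^2 * p) := by field_simp; ring
  rw [h2]
  push_cast
  rw [neg_mul, div_neg, mul_neg, mul_div_assoc', mul_div_mul_left _ _ hr0]
  ring

/-- real version of the kernel integral in `rectC` -/
def kap (G : Measure ℝ) (X : ℝ) : ℝ := ∫ t : ℝ, (1 + t^2) / (1 - X * t^2) ∂G

lemma kap_eq (G : Measure ℝ) (X : ℝ) :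
    ∫ t : ℝ, (1 + (t : ℂ) ^ 2) / (1 - (X:ℂ) * (t : ℂ) ^ 2) ∂G = (kap G X : ℂ) := by
  unfold kap
  rw [← integral_complex_ofReal]
  congr 1
  ext t
  push_cast
  rfl

lemma kap_nonneg (G : Measure ℝ) {X : ℝ} (hX : X < 0) : 0 ≤ kap G X := by
  refine integral_nonneg fun t => ?_
  have : 0 < 1 - X * t^2 := by nlinarith [sq_nonneg t]
  simp only [Pi.zero_apply]
  positivity

lemma rectC_real (G : Measure ℝ) (X : ℝ) : rectC G (X:ℂ) = ((X * kap G X : ℝ) : ℂ) := by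
  rw [rectC, kap_eq]; push_cast; rfl

lemma Mt_real (τ : Measure ℝ) [IsProbabilityMeasure τ] {X : ℝ} (hX : X < 0) :
    ∃ m : ℝ, Mt τ (X:ℂ) = (m:ℂ) ∧ -1 ≤ m := by
  refine ⟨∫ t : ℝ, X * t^2 / (1 - X * t^2) ∂τ, ?_, ?_⟩
  · unfold Mt
    rw [← integral_complex_ofReal]
    congr 1
    ext t
    push_cast
    rfl
  · have hb : ∀ t : ℝ, -1 ≤ X * t^2 / (1 - X * t^2) ∧ X * t^2 / (1 - X * t^2) ≤ 0 := by
      intro t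
      have h1 : X * t^2 ≤ 0 := by nlinarith [sq_nonneg t]
      have : 0 < 1 - X * t^2 := by linarith
      constructor
      · rw [le_div_iff₀ this]; linarith
      · exact div_nonpos_of_nonpos_of_nonneg h1 this.le
    have hi : Integrable (fun t : ℝ => X * t^2 / (1 - X * t^2)) τ := by
      refine Integrable.of_bound (C := 1) ?_ (Eventually.of_forall fun t => ?_)
      · exact Measurable.aestronglyMeasurable (by fun_prop)
      · rw [Real.norm_eq_abs, abs_le]
        exact ⟨(hb t).1, (hb t).2.trans zero_le_one⟩
    have := integral_mono (μ := τ) (integrable_const (-1 : ℝ)) hi (fun t => (hb t).1)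
    simpa using this

/-- minus the Cauchy transform -/
def gg (ρ : Measure ℝ) (b : ℂ) : ℂ := KK (fun _ => 1) ρ (b, -1 / b)

section
variable {l : ℝ} {G ν ρ : Measure ℝ} [IsFiniteMeasure G] [IsProbabilityMeasure ν]
  [IsProbabilityMeasure ρ]

lemma gg_pos {b : ℂ} (hb : 0 < b.im) : 0 < (gg ρ b).im :=
  KK_im_pos (IsProbabilityMeasure.ne_zero ρ) adm_one hb (ninv_im_pos hb)

lemma fix_alg {b : ℂ} (hl : l ∈ Ioo (0:ℝ) 1) (hG : G ≠ 0) (hb : 0 < b.im) {n : ℂ}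
    (hn : n = Mt ρ (1 / (b * b)) - rectC G (Ht l ρ (1 / (b * b)))) :
    Ht l ρ (1 / (b * b)) = gg ρ b * PP l b (gg ρ b) ∧
    gg ρ b * WA l G b (gg ρ b) = -(1 + n) ∧
    1 / (WA l G b (gg ρ b) * WB l G b (gg ρ b)) = Ht l ρ (1 / (b * b)) / Tfun l n ∧
    (Mt ν (Ht l ρ (1 / (b * b)) / Tfun l n) = n → FF l G ν b (gg ρ b) = gg ρ b) := by
  have hp := gg_pos (ρ := ρ) hb
  have hr := PP_pos hl hb.le hp
  have hb0 := ne0_of_im hb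
  have hm := Mt_eq_KK (τ := ρ) hb hb
  have hA := WA_pos (G := G) hl hG hb.le hp
  have hB := WB_pos (G := G) hl hG hb.le hp
  change Mt ρ (1 / (b * b)) = -b * gg ρ b - 1 at hm
  set p := gg ρ b with hpdef
  set r := PP l b p with hrdef
  have hbr : b * r = -(1 + l * Mt ρ (1 / (b * b))) := by
    rw [hm, hrdef, PP]; push_cast; field_simp; ring
  have hH : Ht l ρ (1 / (b * b)) = p * r := by
    have : 1 + l * Mt ρ (1 / (b * b)) = -(b * r) := by rw [hbr]; ring
    rw [Ht, this, hm]; field_simp; ring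
  have c1 := rectC_eq_KK (G := G) hp hr
  have c2 := rectC_eq_KK (G := G) hr hp
  rw [mul_comm r p] at c2
  rw [hH] at hn ⊢
  have hpA : p * WA l G b p = -(1 + n) := by
    rw [WA, mul_add, ← hrdef, ← c1, hn, hm]; ring
  have hrB : r * WB l G b p = -(1 + l * n) := by
    have : r * WB l G b p = b * r + l * (r * KK (fun t => 1 + t ^ 2) G (-1 / p, r)) := by
      rw [WB, ← hrdef]; ring
    rw [this, ← c2, hbr, hn]; ring
  have hT : Tfun l n = (p * WA l G b p) * (r * WB l G b p) := by
    rw [hpA, hrB, Tfun]; ring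
  have hp0 := ne0_of_im hp
  have hr0 := ne0_of_im hr
  have hA0 := ne0_of_im hA
  have hB0 := ne0_of_im hB
  have hw : 1 / (WA l G b p * WB l G b p) = p * r / Tfun l n := by
    rw [hT]; field_simp
  refine ⟨rfl, hpA, hw, fun h => ?_⟩
  rw [← hw, Mt_eq_KK hA hB] at h
  change -WA l G b p * FF l G ν b p - 1 = n at h
  have : WA l G b p * FF l G ν b p = WA l G b p * p := by
    rw [mul_comm _ p, hpA, ← h]; ring
  exact mul_left_cancel₀ hA0 this

lemma fix_neg (hl : l ∈ Ioo (0:ℝ) 1) (hG : G ≠ 0) {ε : ℝ}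
    (hε : ∀ x ∈ Set.Ioo (-ε) (0 : ℝ),
      Tfun l (Mt ρ (x : ℂ) - rectC G (Ht l ρ (x : ℂ))) ≠ 0 ∧
      Ht l ρ (x : ℂ) =
        Ht l ν (Ht l ρ (x : ℂ) / Tfun l (Mt ρ (x : ℂ) - rectC G (Ht l ρ (x : ℂ)))))
    {y : ℝ} (hy : 0 < y) (hyε : -ε < -(1 / y^2)) :
    FF l G ν (y * I) (gg ρ (y * I)) = gg ρ (y * I) := by
  have hb : 0 < ((y:ℂ) * I).im := by simpa using hy
  set x : ℝ := -(1 / y^2) with hx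
  have hx0 : x < 0 := by rw [hx]; simp only [Left.neg_neg_iff]; positivity
  have hz : 1 / (((y:ℂ) * I) * ((y:ℂ) * I)) = (x : ℂ) := by
    have hy0 : (y:ℂ) ≠ 0 := by exact_mod_cast hy.ne'
    rw [hx]; push_cast
    have : ((y:ℂ) * I) * ((y:ℂ) * I) = -(y:ℂ)^2 := by
      have := I_sq; linear_combination (y:ℂ)^2 * this
    rw [this, div_neg]
  obtain ⟨hT, hH⟩ := hε x ⟨hyε, hx0⟩
  obtain ⟨a1, a2, a3, a4⟩ := fix_alg (ν := ν) (ρ := ρ) hl hG hb rfl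
  rw [hz] at a1 a4
  apply a4
  have hp := gg_pos (ρ := ρ) hb
  have hh0 : Ht l ρ (x:ℂ) ≠ 0 := by
    rw [a1]; exact mul_ne_zero (ne0_of_im hp) (ne0_of_im (PP_pos hl hb.le hp))
  clear a1 a2 a3 a4
  obtain ⟨m, hm, hm1⟩ := Mt_real ρ hx0
  obtain ⟨hl0, hl1⟩ := hl
  set h : ℝ := x * (1 + m) * (1 + l * m) with hhdef
  have hh : Ht l ρ (x:ℂ) = (h:ℂ) := by rw [Ht, hm, hhdef]; push_cast; ring
  rw [hh] at hT hH hh0 ⊢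
  have hneg : h < 0 := by
    have hne : h ≠ 0 := by exact_mod_cast hh0
    have : h ≤ 0 := by
      have : 0 ≤ (1 + m) * (1 + l * m) := mul_nonneg (by linarith) (by nlinarith)
      rw [hhdef, mul_assoc]; nlinarith
    exact lt_of_le_of_ne this hne
  rw [rectC_real, hm] at hT hH ⊢
  set n : ℝ := m - h * kap G h with hndef
  have hn1 : -1 ≤ n := by
    have := mul_nonneg_of_nonpos_of_nonpos hneg.le (neg_nonpos.2 (kap_nonneg G hneg))
    rw [hndef]; linarith
  have en : ((m:ℂ) - ((h * kap G h : ℝ) : ℂ)) = (n:ℂ) := by rw [hndef]; push_cast; ring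
  rw [en] at hT hH ⊢
  set T : ℝ := (l * n + 1) * (n + 1) with hTdef
  have eT : Tfun l (n:ℂ) = (T:ℂ) := by rw [Tfun, hTdef]; push_cast; ring
  rw [eT] at hT hH ⊢
  have hT0 : T ≠ 0 := by exact_mod_cast hT
  have hTpos : 0 < T := by
    refine lt_of_le_of_ne ?_ (Ne.symm hT0)
    exact mul_nonneg (by nlinarith) (by linarith)
  have ew : (h:ℂ) / (T:ℂ) = ((h / T : ℝ) : ℂ) := by push_cast; rfl
  rw [ew] at hH ⊢
  have hw : h / T < 0 := div_neg_of_neg_of_pos hneg hTpos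
  obtain ⟨N, hN, hN1⟩ := Mt_real ν hw
  rw [Ht, hN] at hH
  rw [hN]
  have hH' : h = h / T * (1 + N) * (1 + l * N) := by exact_mod_cast hH
  have h1 : T = (1 + N) * (1 + l * N) := by
    field_simp at hH'
    have : h * T = h * ((1 + N) * (1 + l * N)) := by linarith
    exact mul_left_cancel₀ hneg.ne this
  have h2 : (n - N) * (l * (n + N) + 1 + l) = 0 := by rw [hTdef] at h1; linarith
  have h3 : 0 < l * (n + N) + 1 + l := by nlinarith
  have h4 : n - N = 0 := by
    rcases mul_eq_zero.1 h2 with h | h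
    · exact h
    · exact absurd h h3.ne'
  have : N = n := by linarith
  rw [this]

lemma gg_diff {b : ℂ} (hb : 0 < b.im) : DifferentiableAt ℂ (gg ρ) b := by
  unfold gg
  exact DifferentiableAt.comp (g := KK (fun _ => 1) ρ)
    (f := fun b : ℂ => (b, -1 / b)) b (KK_diff adm_one hb (ninv_im_pos hb))
    (differentiableAt_id.prodMk
      ((differentiableAt_const (-1 : ℂ)).div differentiableAt_id (ne0_of_im hb)))

lemma fix_all (hl : l ∈ Ioo (0:ℝ) 1) (hG : G ≠ 0) (hconv : IsRectConv l G ν ρ) {b : ℂ}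
    (hb : 0 < b.im) : FF l G ν b (gg ρ b) = gg ρ b := by
  obtain ⟨ε, hε0, hε⟩ := hconv
  have hd : DifferentiableOn ℂ (fun b => FF l G ν b (gg ρ b) - gg ρ b) UHP := by
    intro b hb
    have hb : 0 < b.im := hb
    refine DifferentiableAt.differentiableWithinAt (DifferentiableAt.sub ?_ (gg_diff hb))
    exact DifferentiableAt.comp (g := fun q : ℂ × ℂ => FF l G ν q.1 q.2)
      (f := fun b : ℂ => (b, gg ρ b)) b (FF_diff hl hG hb.le (ne0_of_im hb) (gg_pos hb))
      (differentiableAt_id.prodMk (gg_diff hb))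
  set y0 : ℝ := 1 / Real.sqrt ε + 1 with hy0
  have hse : 0 < Real.sqrt ε := Real.sqrt_pos.2 hε0
  have hy00 : 0 < 1 / Real.sqrt ε := by positivity
  have hz := (hd.analyticOnNhd UHP_open).eqOn_zero_of_preconnected_of_frequently_eq_zero UHP_conv
    (z₀ := (y0:ℂ) * I) ?_ ?_
  · have := hz (show b ∈ UHP from hb)
    simpa [sub_eq_zero] using this
  · change 0 < ((y0:ℂ) * I).im
    have : 0 < y0 := by linarith
    simpa using this
  · have hcont : Continuous (fun y : ℝ => (y:ℂ) * I) := by fun_prop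
    have ht : Tendsto (fun y : ℝ => (y:ℂ) * I) (𝓝[≠] y0) (𝓝[≠] ((y0:ℂ) * I)) := by
      refine tendsto_nhdsWithin_of_tendsto_nhds_of_eventually_within _
        (hcont.continuousAt.tendsto.mono_left nhdsWithin_le_nhds) ?_
      filter_upwards [self_mem_nhdsWithin] with y h1 h2
      apply h1
      have := mul_right_cancel₀ I_ne_zero h2
      exact_mod_cast this
    refine ht.frequently (Eventually.frequently ?_)
    filter_upwards [mem_nhdsWithin_of_mem_nhds
      (Ioi_mem_nhds (show 1 / Real.sqrt ε < y0 by linarith))] with y hy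
    have hy : 1 / Real.sqrt ε < y := hy
    have hypos : 0 < y := hy00.trans hy
    rw [fix_neg hl hG hε hypos, sub_self]
    rw [neg_lt_neg_iff, div_lt_iff₀ (by positivity)]
    rw [div_lt_iff₀ hse] at hy
    have h5 : 1 < (y * Real.sqrt ε)^2 := by nlinarith
    rw [mul_pow, Real.sq_sqrt hε0.le] at h5
    linarith

end


section
variable {l : ℝ} {G ν ρ : Measure ℝ} [IsFiniteMeasure G] [IsProbabilityMeasure ν]
  [IsProbabilityMeasure ρ]

lemma FF_bdd (hl : l ∈ Ioo (0:ℝ) 1) (hG : G ≠ 0) {b0 : ℝ} (hb0 : b0 ≠ 0) {c : ℝ} (hc : 0 < c)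
    (hev : ∀ᶠ X : ℝ in atBot, X * (kap G X)^2 ≤ -c) :
    ∃ B : ℝ, ∀ᶠ y : ℝ in atTop, ∃ p : ℂ, p.im = y ∧ ‖FF l G ν (b0:ℂ) p‖ ≤ B := by
  have hl0 := hl.1
  set r : ℝ := (1 - l) / b0 with hr
  set D : ℝ := l + r^2 / (4 * l) with hD
  have hD0 : 0 < D := by positivity
  set s : ℝ := l * Real.sqrt (c / D) with hs
  have hs0 : 0 < s := by positivity
  have ht : Tendsto (fun y : ℝ => -(l * y^2 + r^2 / (4 * l))) atTop atBot := by
    refine tendsto_neg_atTop_atBot.comp ?_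
    refine tendsto_atTop_add_const_right _ _ ?_
    exact (tendsto_pow_atTop two_ne_zero).const_mul_atTop hl0
  refine ⟨1 / s, ?_⟩
  filter_upwards [ht.eventually hev, eventually_ge_atTop (1:ℝ)] with y hy hy1
  set X : ℝ := -(l * y^2 + r^2 / (4 * l)) with hX
  have hy0 : 0 < y := by linarith
  have hX0 : X < 0 := by
    have : 0 < l * y^2 + r^2 / (4 * l) := by positivity
    linarith
  set P : ℂ := ((r / (2 * l) : ℝ) : ℂ) + (y:ℂ) * I with hP
  have hPim : P.im = y := by rw [hP, add_im, ofReal_im, im_ofReal_mul]; simp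
  refine ⟨P, hPim, ?_⟩
  have hP0 : 0 < P.im := by rw [hPim]; exact hy0
  have hb : 0 ≤ ((b0:ℂ)).im := by simp
  have hlc : (l:ℂ) ≠ 0 := by exact_mod_cast hl0.ne'
  have hbc : (b0:ℂ) ≠ 0 := by exact_mod_cast hb0
  have ePP : PP l (b0:ℂ) P = ((-(r / 2) : ℝ) : ℂ) + ((l * y : ℝ) : ℂ) * I := by
    rw [PP, hP, hr]; push_cast; field_simp; ring
  have hPP := PP_pos hl hb hP0
  have eX : P * PP l (b0:ℂ) P = (X:ℂ) := by
    rw [ePP, hP, hX]; push_cast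
    field_simp
    have := I_sq
    linear_combination (16 * (l:ℂ)^2 * (y:ℂ)^2) * this
  have eK : KK (fun t => 1 + t^2) G (-1 / PP l (b0:ℂ) P, P) = PP l (b0:ℂ) P * (kap G X : ℂ) := by
    have h := rectC_eq_KK (G := G) hP0 hPP
    rw [eX, rectC_real] at h
    apply mul_left_cancel₀ (ne0_of_im hP0)
    rw [← h, ← mul_assoc, eX]; push_cast; rfl
  have hk := kap_nonneg G hX0
  have eW : (WA l G (b0:ℂ) P).im = l * y * kap G X := by
    rw [WA, eK, ePP, add_im, mul_comm, im_ofReal_mul]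
    simp
    ring
  have hsW : s ≤ (WA l G (b0:ℂ) P).im := by
    rw [eW]
    refine (pow_le_pow_iff_left₀ hs0.le (by positivity) two_ne_zero).1 ?_
    rw [hs, mul_pow, Real.sq_sqrt (by positivity), mul_pow, mul_pow, mul_assoc]
    refine mul_le_mul_of_nonneg_left ?_ (by positivity)
    rw [div_le_iff₀ hD0]
    have h1 : -X ≤ y^2 * D := by
      have hh : 0 ≤ r^2 / (4 * l) := by positivity
      have hy2 : 1 ≤ y^2 := by nlinarith
      rw [hX, hD]; nlinarith
    nlinarith [mul_le_mul_of_nonneg_right h1 (sq_nonneg (kap G X))]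
  have hW := WA_pos (G := G) hl hG hb hP0
  refine (KK_norm_le hW (ninv_im_pos (WB_pos hl hG hb hP0))).trans ?_
  exact one_div_le_one_div_of_le hs0 hsW

lemma gg_limit (hl : l ∈ Ioo (0:ℝ) 1) (hconv : IsRectConv l G ν ρ)
    (hC2 : ∃ L : EReal, L ≤ 0 ∧ L ≠ 0 ∧
      Tendsto (fun x : ℝ => (((rectC G (x : ℂ)) ^ 2 / (x : ℂ)).re : EReal)) atBot
        (nhds L)) {b0 : ℝ} (hb0 : b0 ≠ 0) :
    ∃ L : ℂ, Tendsto (gg ρ) (𝓝[UHP] (b0:ℂ)) (𝓝 L) := by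
  obtain ⟨L, hL0, hLne, hL⟩ := hC2
  have hG : G ≠ 0 := by
    rintro rfl
    apply hLne
    refine tendsto_nhds_unique hL ?_
    simp [rectC]
  have hLlt : L < ((0:ℝ) : EReal) := lt_of_le_of_ne (by simpa using hL0) (by simpa using hLne)
  obtain ⟨c, hc1, hc2⟩ := EReal.lt_iff_exists_real_btwn.1 hLlt
  have hc2 : c < 0 := by exact_mod_cast hc2
  have hev : ∀ᶠ X : ℝ in atBot, X * (kap G X)^2 ≤ -(-c) := by
    filter_upwards [hL.eventually (gt_mem_nhds hc1), eventually_lt_atBot (0:ℝ)] with X hX hX0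
    rw [rectC_real] at hX
    have e : (((X * kap G X : ℝ) : ℂ)^2 / (X:ℂ)).re = X * (kap G X)^2 := by
      have : ((X * kap G X : ℝ) : ℂ)^2 / (X:ℂ) = ((X * (kap G X)^2 : ℝ) : ℂ) := by
        have : (X:ℂ) ≠ 0 := by exact_mod_cast hX0.ne
        push_cast; field_simp
      rw [this, ofReal_re]
    rw [e] at hX
    have hX : X * (kap G X)^2 < c := by exact_mod_cast hX
    linarith
  obtain ⟨B, hB⟩ := FF_bdd (ν := ν) hl hG hb0 (by linarith : 0 < -c) hev
  have hbim : 0 ≤ ((b0:ℂ)).im := by simp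
  have hbc : (b0:ℂ) ≠ 0 := by exact_mod_cast hb0
  have hne : (𝓝[UHP] (b0:ℂ)).NeBot := by
    rw [← mem_closure_iff_nhdsWithin_neBot]
    have : closure UHP = {z : ℂ | 0 ≤ z.im} := Complex.closure_setOfPred_lt_im 0
    rw [this]; exact hbim
  refine abstract_limit (Fb := FF l G ν) (F := FF l G ν (b0:ℂ)) ?_ ?_ ?_ ?_ ?_ hB
  · intro p hp
    have h := (FF_diff (ν := ν) hl hG hbim hbc hp).continuousAt
    have h2 : ContinuousAt (fun b : ℂ => FF l G ν b p) (b0:ℂ) :=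
      ContinuousAt.comp (g := fun q : ℂ × ℂ => FF l G ν q.1 q.2) (f := fun b : ℂ => (b, p)) h
        (by fun_prop)
    exact h2.tendsto.mono_left nhdsWithin_le_nhds
  · filter_upwards [self_mem_nhdsWithin] with b hb
    exact gg_pos hb
  · intro p hp
    filter_upwards [self_mem_nhdsWithin] with b hb
    exact FF_contr hl hG (le_of_lt hb) hp (gg_pos hb) (fix_all hl hG hconv hb)
  · intro p hp
    exact FF_pos hl hG hbim hp
  · intro p hp
    have hp : 0 < p.im := hp
    refine DifferentiableAt.differentiableWithinAt ?_
    exact DifferentiableAt.comp (g := fun q : ℂ × ℂ => FF l G ν q.1 q.2)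
      (f := fun p : ℂ => ((b0:ℂ), p)) p (FF_diff hl hG hbim hbc hp) (by fun_prop)

lemma Mt_limit {x : ℝ} (hx : 0 < x)
    (h : ∀ b0 : ℝ, b0 ≠ 0 → ∃ L : ℂ, Tendsto (gg ρ) (𝓝[UHP] (b0:ℂ)) (𝓝 L)) :
    ∃ Lm : ℂ, Tendsto (Mt ρ) (𝓝[UHP] (x:ℂ)) (𝓝 Lm) := by
  set S : ℂ → ℂ := fun z => z ^ (1/2 : ℂ) with hS
  have hSx : S (x:ℂ) = ((Real.sqrt x : ℝ) : ℂ) := by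
    rw [hS, Real.sqrt_eq_rpow, ofReal_cpow hx.le]; push_cast; rfl
  have hsx : 0 < Real.sqrt x := Real.sqrt_pos.2 hx
  have hS2 : ∀ z, S z * S z = z := by
    intro z
    have := cpow_nat_inv_pow z two_ne_zero
    rw [← sq, hS]; simpa using this
  have hSim : ∀ z ∈ UHP, 0 < (S z).im := by
    intro z hz
    have hz : 0 < z.im := hz
    have hz0 := ne0_of_im hz
    have ha := arg_nonneg_iff.2 hz.le
    have ha1 : 0 < arg z := by
      refine lt_of_le_of_ne ha (fun h0 => ?_)
      have := (arg_eq_zero_iff.1 h0.symm).2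
      exact hz.ne' this
    have ha2 := arg_le_pi z
    have : S z = exp (log z * (1/2 : ℂ)) := cpow_def_of_ne_zero hz0 _
    rw [this, exp_im]
    refine mul_pos (Real.exp_pos _) ?_
    have e : (log z * (1/2 : ℂ)).im = arg z / 2 := by
      rw [mul_comm]
      have : (1/2 : ℂ) = ((1/2 : ℝ) : ℂ) := by push_cast; rfl
      rw [this, im_ofReal_mul, log_im]; ring
    rw [e]
    exact Real.sin_pos_of_pos_of_lt_pi (by linarith) (by linarith [Real.pi_pos])
  have hScont : ContinuousAt S (x:ℂ) :=
    continuousAt_id.cpow continuousAt_const (Or.inl hx)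
  have hS0 : S (x:ℂ) ≠ 0 := by rw [hSx]; exact_mod_cast hsx.ne'
  set b : ℂ → ℂ := fun z => -1 / S z with hb
  have hbcont : ContinuousAt b (x:ℂ) := continuousAt_const.div hScont hS0
  have hbx : b (x:ℂ) = ((-1 / Real.sqrt x : ℝ) : ℂ) := by
    rw [hb]; simp only; rw [hSx]; push_cast; rfl
  have hbpos : ∀ z ∈ UHP, 0 < (b z).im := fun z hz => ninv_im_pos (hSim z hz)
  obtain ⟨L, hL⟩ := h (-1 / Real.sqrt x) (div_ne_zero (by norm_num) hsx.ne')
  rw [← hbx] at hL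
  have hbt : Tendsto b (𝓝[UHP] (x:ℂ)) (𝓝 (b x)) := hbcont.tendsto.mono_left nhdsWithin_le_nhds
  have hbt2 : Tendsto b (𝓝[UHP] (x:ℂ)) (𝓝[UHP] (b x)) := by
    refine tendsto_nhdsWithin_of_tendsto_nhds_of_eventually_within _ hbt ?_
    filter_upwards [self_mem_nhdsWithin] with z hz
    exact hbpos z hz
  refine ⟨-(b x) * L - 1, ?_⟩
  have ht : Tendsto (fun z => -(b z) * gg ρ (b z) - 1) (𝓝[UHP] (x:ℂ)) (𝓝 (-(b x) * L - 1)) :=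
    (hbt.neg.mul (hL.comp hbt2)).sub_const 1
  refine ht.congr' ?_
  filter_upwards [self_mem_nhdsWithin] with z hz
  have hbz := hbpos z hz
  have e : 1 / (b z * b z) = z := by
    have h0 := ne0_of_im (hSim z hz)
    have h1 := hS2 z
    rw [hb]; simp only
    generalize S z = w at *
    rw [← h1]; field_simp
  have := Mt_eq_KK (τ := ρ) hbz hbz
  rw [e] at this
  rw [this]; rfl

end


/-- Under the additional hypothesis that `lim_{x→-∞} C(x)²/x` exists in
`[-∞,0]` and is nonzero, the boundary limits of `M_ρ` and `H_ρ` from `ℂ⁺` at any point of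
`(0,∞)` exist and are finite. -/
theorem stmt16 (l : ℝ) (hl : l ∈ Set.Ioo (0 : ℝ) 1)
    (μ : Measure ℝ) [IsProbabilityMeasure μ] (hμ0 : μ ≠ Measure.dirac (0 : ℝ))
    (hμsym : Measure.map (fun t : ℝ => -t) μ = μ)
    (G : Measure ℝ) [IsFiniteMeasure G]
    (hGsym : Measure.map (fun t : ℝ => -t) G = G)
    (hID : IsRectInfDiv l μ G)
    (ν ρ : Measure ℝ) [IsProbabilityMeasure ν] [IsProbabilityMeasure ρ]
    (hνsym : Measure.map (fun t : ℝ => -t) ν = ν)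
    (hρsym : Measure.map (fun t : ℝ => -t) ρ = ρ)
    (hconv : IsRectConv l G ν ρ)
    (hC2 : ∃ L : EReal, L ≤ 0 ∧ L ≠ 0 ∧
      Tendsto (fun x : ℝ => (((rectC G (x : ℂ)) ^ 2 / (x : ℂ)).re : EReal)) atBot
        (nhds L)) :
    ∀ x : ℝ, 0 < x →
      (∃ Lm : ℂ, Tendsto (Mt ρ) (nhdsWithin (x : ℂ) UHP) (nhds Lm)) ∧
      (∃ Lh : ℂ, Tendsto (Ht l ρ) (nhdsWithin (x : ℂ) UHP) (nhds Lh)) := by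
  intro x hx
  obtain ⟨Lm, hLm⟩ := Mt_limit (ρ := ρ) hx (fun b0 hb0 => gg_limit hl hconv hC2 hb0)
  refine ⟨⟨Lm, hLm⟩, ⟨(x:ℂ) * (1 + Lm) * (1 + (l:ℂ) * Lm), ?_⟩⟩
  have hid : Tendsto (fun z : ℂ => z) (nhdsWithin (x:ℂ) UHP) (nhds (x:ℂ)) :=
    tendsto_id.mono_left nhdsWithin_le_nhds
  exact (hid.mul (hLm.const_add 1)).mul ((hLm.const_mul (l:ℂ)).const_add 1)

end
end

section
/- Let λ ∈ (0,1); let μ ≠ δ₀ be a symmetric Borel probability measure on ℝ that is ⊞_λ-infinitely divisible with rectangular R-transform C, and let ν, ρ be symmetric Borel probability measures on ℝ such that ρ is the rectangular free convolution μ ⊞_λ ν. Assume moreover that the limit of C(x)²/x as x → −∞ exists in [−∞, 0] and is nonzero. Then ρ is absolutely continuous with respect to Lebesgue measure and admits a density that is continuous on all of ℝ. -/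
open MeasureTheory Complex Set Filter Topology

noncomputable section

def Dm (m : Measure ℝ) (s : ℂ) : ℂ := ∫ t : ℝ, 1 / (s - (t : ℂ) ^ 2) ∂m

def Em (m : Measure ℝ) (h : ℂ) : ℂ := ∫ t : ℝ, (1 + (t : ℂ) ^ 2) / (1 - h * (t : ℂ) ^ 2) ∂m

lemma slit_dist {s : ℂ} (hs : -s ∈ slitPlane) :
    ∃ ε > (0 : ℝ), ∀ s' ∈ Metric.ball s ε, ∀ t : ℝ, ε ≤ ‖s' - (t : ℂ) ^ 2‖ := by
  obtain ⟨δ, hδ, hb⟩ := Metric.isOpen_iff.1 isOpen_slitPlane _ hs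
  refine ⟨δ / 2, by positivity, fun s' hs' t => ?_⟩
  by_contra! hlt
  have : -(t : ℂ) ^ 2 ∈ Metric.ball (-s) δ := by
    rw [Metric.mem_ball, dist_eq_norm] at *
    have e : -(t : ℂ) ^ 2 - -s = (s' - (t : ℂ) ^ 2) - (s' - s) := by ring
    rw [e]
    have := norm_sub_le (s' - (t : ℂ) ^ 2) (s' - s)
    linarith
  have h2 := hb this
  rw [mem_slitPlane_iff] at h2
  have e1 : (-(t : ℂ) ^ 2) = ((-(t ^ 2) : ℝ) : ℂ) := by push_cast; ring
  rw [e1] at h2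
  simp only [ofReal_re, ofReal_im] at h2
  rcases h2 with h2 | h2
  · nlinarith [sq_nonneg t]
  · exact h2 rfl

lemma slit_ne {s : ℂ} (hs : -s ∈ slitPlane) (t : ℝ) : s - (t : ℂ) ^ 2 ≠ 0 := by
  obtain ⟨ε, hε, h⟩ := slit_dist hs
  have := h s (Metric.mem_ball_self hε) t
  intro h0
  rw [h0, norm_zero] at this
  linarith

lemma Dm_integrable (m : Measure ℝ) [IsFiniteMeasure m] {s : ℂ} (hs : -s ∈ slitPlane) :
    Integrable (fun t : ℝ => 1 / (s - (t : ℂ) ^ 2)) m := by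
  obtain ⟨ε, hε, h⟩ := slit_dist hs
  refine Integrable.of_bound (C := ε⁻¹) (by measurability) (ae_of_all _ fun t => ?_)
  rw [norm_div, norm_one, one_div]
  exact inv_anti₀ hε (h s (Metric.mem_ball_self hε) t)

lemma Dm_diff (m : Measure ℝ) [IsFiniteMeasure m] {s : ℂ} (hs : -s ∈ slitPlane) :
    DifferentiableAt ℂ (Dm m) s := by
  obtain ⟨ε, hε, h⟩ := slit_dist hs
  have key := hasDerivAt_integral_of_dominated_loc_of_deriv_le (μ := m) (𝕜 := ℂ)
    (F := fun s (t : ℝ) => 1 / (s - (t : ℂ) ^ 2))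
    (F' := fun s (t : ℝ) => -1 / (s - (t : ℂ) ^ 2) ^ 2) (x₀ := s) (s := Metric.ball s ε)
    (bound := fun _ => (ε ^ 2)⁻¹) (Metric.ball_mem_nhds s hε)
    (Eventually.of_forall fun x => by measurability) (Dm_integrable m hs)
    (Measurable.aestronglyMeasurable (by fun_prop))
    (ae_of_all _ fun t x hx => ?_) (integrable_const _) (ae_of_all _ fun t x hx => ?_)
  · exact key.2.differentiableAt
  · rw [norm_div, norm_neg, norm_one, one_div, norm_pow]
    exact inv_anti₀ (by positivity) (pow_le_pow_left₀ hε.le (h x hx t) 2)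
  · have hne : x - (t : ℂ) ^ 2 ≠ 0 := by
      intro h0
      have := h x hx t
      rw [h0, norm_zero] at this
      linarith
    have := ((hasDerivAt_id x).sub_const ((t : ℂ) ^ 2)).inv hne
    simp only [one_div]
    have h2 : (fun y : ℂ => (y - (t : ℂ) ^ 2)⁻¹) = (fun y : ℂ => id y - (t : ℂ) ^ 2)⁻¹ := by
      ext y; simp
    rw [h2]
    exact this

lemma slit_inv {h : ℂ} (hh : -h ∈ slitPlane) : -h⁻¹ ∈ slitPlane := by
  rw [← inv_neg]
  rw [mem_slitPlane_iff] at *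
  have hn : 0 < normSq (-h) := by
    rw [normSq_pos]; rintro h0; rw [h0] at hh; simp at hh
  rw [inv_re, inv_im]
  rcases hh with h1 | h1
  · left; positivity
  · right; exact div_ne_zero (neg_ne_zero.2 h1) hn.ne'

lemma slit_ne0 {h : ℂ} (hh : -h ∈ slitPlane) : h ≠ 0 := by
  rintro rfl; simp at hh

lemma Em_point {h : ℂ} (hh : -h ∈ slitPlane) (t : ℝ) :
    (1 + (t : ℂ) ^ 2) / (1 - h * (t : ℂ) ^ 2) =
      h⁻¹ * (-1 + (1 + h⁻¹) * (1 / (h⁻¹ - (t : ℂ) ^ 2))) := by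
  have h0 := slit_ne0 hh
  have h1 := slit_ne (slit_inv hh) t
  have h2 : 1 - h * (t : ℂ) ^ 2 = h * (h⁻¹ - (t : ℂ) ^ 2) := by field_simp
  rw [h2]
  have h3 : (1 + (t : ℂ) ^ 2) = -(h⁻¹ - (t : ℂ) ^ 2) + (1 + h⁻¹) := by ring
  rw [h3]
  generalize h⁻¹ - (t : ℂ) ^ 2 = q at *
  field_simp

lemma one_sub_ne {h : ℂ} (hh : -h ∈ slitPlane) (t : ℝ) : 1 - h * (t : ℂ) ^ 2 ≠ 0 := by
  have h0 := slit_ne0 hh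
  have h1 := slit_ne (slit_inv hh) t
  have h2 : 1 - h * (t : ℂ) ^ 2 = h * (h⁻¹ - (t : ℂ) ^ 2) := by field_simp
  rw [h2]; exact mul_ne_zero h0 h1

lemma Em_integrable (m : Measure ℝ) [IsFiniteMeasure m] {h : ℂ} (hh : -h ∈ slitPlane) :
    Integrable (fun t : ℝ => (1 + (t : ℂ) ^ 2) / (1 - h * (t : ℂ) ^ 2)) m := by
  simp_rw [Em_point hh]
  exact (((integrable_const (-1 : ℂ)).add ((Dm_integrable m (slit_inv hh)).const_mul _)).const_mul _)

lemma Em_eq (m : Measure ℝ) [IsFiniteMeasure m] {h : ℂ} (hh : -h ∈ slitPlane) :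
    Em m h = h⁻¹ * (-(m.real univ : ℂ) + (1 + h⁻¹) * Dm m h⁻¹) := by
  unfold Em
  simp_rw [Em_point hh]
  rw [integral_const_mul, integral_add (integrable_const (-1 : ℂ))
    ((Dm_integrable m (slit_inv hh)).const_mul _), integral_const_mul, integral_const]
  simp [Dm]

lemma Em_diff (m : Measure ℝ) [IsFiniteMeasure m] {h : ℂ} (hh : -h ∈ slitPlane) :
    DifferentiableAt ℂ (Em m) h := by
  have hopen : ∀ᶠ x in 𝓝 h, -x ∈ slitPlane :=
    (continuous_neg.tendsto h).eventually (isOpen_slitPlane.mem_nhds hh)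
  have : DifferentiableAt ℂ (fun h => h⁻¹ * (-(m.real univ : ℂ) + (1 + h⁻¹) * Dm m h⁻¹)) h := by
    have hi : DifferentiableAt ℂ (fun x : ℂ => x⁻¹) h := differentiableAt_inv (slit_ne0 hh)
    have hd : DifferentiableAt ℂ (fun x : ℂ => Dm m x⁻¹) h :=
      DifferentiableAt.comp (g := Dm m) h (Dm_diff m (slit_inv hh)) hi
    exact hi.mul (((hi.const_add 1).mul hd).const_add _)
  exact this.congr_of_eventuallyEq (hopen.mono fun x hx => Em_eq m hx)

lemma slit_mul {a b : ℂ} (ha : a.im < 0) (hb : b.im < 0) : -(a * b) ∈ slitPlane := by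
  rw [mem_slitPlane_iff]
  by_cases h : (a * b).im = 0
  · left
    rw [mul_im] at h
    rw [neg_re, mul_re]
    have h3 : a.re * b.im = - (a.im * b.re) := by linarith
    have h4 : a.re * b.re * (b.im) = - (a.im * b.re ^ 2) := by
      linear_combination b.re * h3
    have h6 : a.re * b.re * b.im ≥ 0 := by rw [h4]; nlinarith [sq_nonneg b.re]
    have h7 : a.re * b.re ≤ 0 := by
      by_contra! h8
      nlinarith
    nlinarith [mul_pos_of_neg_of_neg ha hb]
  · right; rw [neg_im]; exact neg_ne_zero.2 h

lemma slit_mul' {a b : ℂ} (ha : 0 < a.im) (hb : 0 < b.im) : -(a * b) ∈ slitPlane := by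
  have := slit_mul (a := -a) (b := -b) (by simpa using ha) (by simpa using hb)
  simpa using this

/-- pointwise lower bound -/
lemma pointwise_bd {a b : ℂ} (ha : a.im < 0) (hb : b.im < 0) {v1 v2 : ℝ} (h1 : 0 < v1) (h2 : 0 < v2)
    (hva : v1 * ‖a‖ ^ 2 ≤ -a.im) (hvb : v2 * ‖b‖ ^ 2 ≤ -b.im) (t : ℝ) :
    2 * ‖a * b‖ / (1 + ‖a * b‖ * t ^ 2) ≤
      -(b / (1 - a * b * (t : ℂ) ^ 2)).im / v1 + -(a / (1 - a * b * (t : ℂ) ^ 2)).im / v2 := by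
  have hne := one_sub_ne (slit_mul ha hb) t
  have key : ∀ a b : ℂ, -(b / (1 - a * b * (t : ℂ) ^ 2)).im =
      (-b.im + ‖b‖ ^ 2 * t ^ 2 * (-a.im)) / ‖1 - a * b * (t : ℂ) ^ 2‖ ^ 2 := by
    intro a b
    rw [← normSq_eq_norm_sq (1 - a * b * (t : ℂ) ^ 2), div_im, ← normSq_eq_norm_sq b]
    rw [← sub_div, ← neg_div]
    congr 1
    rw [normSq_apply]
    have e : ((t : ℂ) ^ 2) = ((t ^ 2 : ℝ) : ℂ) := by push_cast; rfl
    rw [e]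
    simp only [sub_re, sub_im, mul_re, mul_im, ofReal_re, ofReal_im, one_re, one_im]
    ring
  have hN : ‖1 - a * b * (t : ℂ) ^ 2‖ ≤ 1 + ‖a * b‖ * t ^ 2 := by
    refine (norm_sub_le _ _).trans ?_
    simp
  have hN0 : 0 < ‖1 - a * b * (t : ℂ) ^ 2‖ := norm_pos_iff.2 hne
  rw [key a b, mul_comm a b, key b a, mul_comm b a]
  set N := ‖1 - a * b * (t : ℂ) ^ 2‖
  rw [norm_mul] at hN ⊢
  have hA : 0 < ‖a‖ := norm_pos_iff.2 (by rintro rfl; simp at ha)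
  have hB : 0 < ‖b‖ := norm_pos_iff.2 (by rintro rfl; simp at hb)
  set A := ‖a‖
  set B := ‖b‖
  have ht : 0 ≤ t ^ 2 := sq_nonneg t
  generalize t ^ 2 = τ at *
  set D := 1 + A * B * τ with hD
  have hD0 : 0 < D := by positivity
  have s1 : (v2 * B ^ 2 + B ^ 2 * τ * (v1 * A ^ 2)) / N ^ 2 / v1 ≤
      (-b.im + B ^ 2 * τ * (-a.im)) / N ^ 2 / v1 := by gcongr
  have s2 : (v1 * A ^ 2 + A ^ 2 * τ * (v2 * B ^ 2)) / N ^ 2 / v2 ≤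
      (-a.im + A ^ 2 * τ * (-b.im)) / N ^ 2 / v2 := by gcongr
  refine le_trans ?_ (add_le_add s1 s2)
  have s3 : 2 * (A * B) / D ≤ 2 * (A * B) * D / N ^ 2 := by
    rw [div_le_div_iff₀ hD0 (by positivity)]
    have : N ^ 2 ≤ D ^ 2 := by gcongr
    have hAB : 0 < A * B := by positivity
    nlinarith
  refine s3.trans ?_
  have s4 : (v2 * B ^ 2 + B ^ 2 * τ * (v1 * A ^ 2)) / N ^ 2 / v1 +
      (v1 * A ^ 2 + A ^ 2 * τ * (v2 * B ^ 2)) / N ^ 2 / v2 =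
      (v2 / v1 * B ^ 2 + v1 / v2 * A ^ 2 + 2 * A ^ 2 * B ^ 2 * τ) / N ^ 2 := by
    field_simp; ring
  rw [s4]
  gcongr
  have s5 : 2 * (A * B) ≤ v2 / v1 * B ^ 2 + v1 / v2 * A ^ 2 := by
    have : v2 / v1 * B ^ 2 + v1 / v2 * A ^ 2 - 2 * (A * B) = (v2 * B - v1 * A) ^ 2 / (v1 * v2) := by
      field_simp; ring
    have h0 : 0 ≤ (v2 * B - v1 * A) ^ 2 / (v1 * v2) := by positivity
    linarith
  rw [hD]; nlinarith

lemma disc_iff {v : ℝ} (hv : 0 < v) (g : ℂ) :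
    ‖g + ((1 / (2 * v) : ℝ) : ℂ) * I‖ ≤ 1 / (2 * v) ↔ v * ‖g‖ ^ 2 ≤ -g.im := by
  rw [← sq_le_sq₀ (norm_nonneg _) (by positivity), ← normSq_eq_norm_sq, ← normSq_eq_norm_sq,
    normSq_apply, normSq_apply]
  simp only [add_re, add_im, mul_re, mul_im, ofReal_re, ofReal_im, I_re, I_im]
  have : (g.re + (1 / (2 * v) * 0 - 0 * 1)) * (g.re + (1 / (2 * v) * 0 - 0 * 1)) +
    (g.im + (1 / (2 * v) * 1 + 0 * 0)) * (g.im + (1 / (2 * v) * 1 + 0 * 0)) - (1 / (2 * v)) ^ 2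
     = (v * (g.re * g.re + g.im * g.im) + g.im) / v := by
    field_simp; ring
  rw [← sub_nonpos, this, div_nonpos_iff]
  constructor
  · rintro (⟨h1, h2⟩ | ⟨h1, h2⟩)
    · linarith
    · linarith
  · intro h; right; constructor <;> linarith

/-- pointwise disc membership -/
lemma disc_point {a b : ℂ} (ha : 0 < a.im) (hb : 0 < b.im) (t : ℝ) :
    a.im * ‖b / (a * b - (t : ℂ) ^ 2)‖ ^ 2 ≤ -(b / (a * b - (t : ℂ) ^ 2)).im := by
  have hne := slit_ne (slit_mul' ha hb) t
  have hN : 0 < normSq (a * b - (t : ℂ) ^ 2) := normSq_pos.2 hne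
  have key : -(b / (a * b - (t : ℂ) ^ 2)).im =
      (a.im * normSq b + t ^ 2 * b.im) / normSq (a * b - (t : ℂ) ^ 2) := by
    rw [div_im, ← sub_div, ← neg_div]
    congr 1
    rw [normSq_apply]
    have e : ((t : ℂ) ^ 2) = ((t ^ 2 : ℝ) : ℂ) := by push_cast; rfl
    rw [e]
    simp only [sub_re, sub_im, mul_re, mul_im, ofReal_re, ofReal_im]
    ring
  rw [key, ← normSq_eq_norm_sq, normSq_div, ← mul_div_assoc]
  gcongr
  nlinarith [mul_nonneg (sq_nonneg t) hb.le]

lemma disc_int (ν : Measure ℝ) [IsProbabilityMeasure ν] {a b : ℂ} (ha : 0 < a.im) (hb : 0 < b.im) :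
    a.im * ‖b * Dm ν (a * b)‖ ^ 2 ≤ -(b * Dm ν (a * b)).im := by
  rw [← disc_iff ha]
  have hintg : Integrable (fun t : ℝ => b / (a * b - (t : ℂ) ^ 2)) ν := by
    have := (Dm_integrable ν (slit_mul' ha hb)).const_mul b
    simp_rw [mul_one_div] at this
    exact this
  have e : b * Dm ν (a * b) + ((1 / (2 * a.im) : ℝ) : ℂ) * I =
      ∫ t : ℝ, (b / (a * b - (t : ℂ) ^ 2) + ((1 / (2 * a.im) : ℝ) : ℂ) * I) ∂ν := by
    rw [integral_add hintg (integrable_const _), integral_const]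
    simp [Dm, ← integral_const_mul, div_eq_mul_inv]
  rw [e]
  have := norm_integral_le_of_norm_le_const (μ := ν) (C := 1 / (2 * a.im))
    (f := fun t : ℝ => (b / (a * b - (t : ℂ) ^ 2) + ((1 / (2 * a.im) : ℝ) : ℂ) * I))
    (ae_of_all _ fun t => (disc_iff ha _).2 (disc_point ha hb t))
  simpa using this

lemma disc_conv (l : ℝ) (hl : l ∈ Set.Ioo (0 : ℝ) 1) {a g : ℂ} (ha : 0 < a.im)
    (hg : a.im * ‖g‖ ^ 2 ≤ -g.im) :
    a.im * ‖(l : ℂ) * g + (1 - l) / a‖ ^ 2 ≤ -((l : ℂ) * g + (1 - l) / a).im := by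
  have h2 : a.im * ‖a⁻¹‖ ^ 2 ≤ -(a⁻¹).im := by
    rw [inv_im, ← normSq_eq_norm_sq, normSq_inv, neg_div, neg_neg, div_eq_mul_inv]
  rw [← disc_iff ha] at *
  have e : (l : ℂ) * g + (1 - l) / a + ((1 / (2 * a.im) : ℝ) : ℂ) * I =
      (l : ℂ) * (g + ((1 / (2 * a.im) : ℝ) : ℂ) * I) +
      ((1 - l : ℝ) : ℂ) * (a⁻¹ + ((1 / (2 * a.im) : ℝ) : ℂ) * I) := by
    push_cast; ring
  rw [e]
  refine (norm_add_le _ _).trans ?_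
  rw [norm_mul, norm_mul, norm_real, norm_real, Real.norm_of_nonneg hl.1.le,
    Real.norm_of_nonneg (by linarith [hl.2])]
  have h3 := mul_le_mul_of_nonneg_left hg hl.1.le
  have h4 := mul_le_mul_of_nonneg_left h2 (by linarith [hl.2] : 0 ≤ 1 - l)
  nlinarith

lemma mulEm_im (G : Measure ℝ) [IsFiniteMeasure G] {a b : ℂ} (ha : a.im < 0) (hb : b.im < 0) :
    Integrable (fun t : ℝ => (1 + t ^ 2) * -(b / (1 - a * b * (t : ℂ) ^ 2)).im) G ∧
    -(b * Em G (a * b)).im = ∫ t : ℝ, (1 + t ^ 2) * -(b / (1 - a * b * (t : ℂ) ^ 2)).im ∂G := by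
  have hI := (Em_integrable G (slit_mul ha hb)).const_mul b
  have e : (fun t : ℝ => (1 + t ^ 2) * -(b / (1 - a * b * (t : ℂ) ^ 2)).im) =
      fun t : ℝ => -(b * ((1 + (t : ℂ) ^ 2) / (1 - a * b * (t : ℂ) ^ 2))).im := by
    ext t
    have : b * ((1 + (t : ℂ) ^ 2) / (1 - a * b * (t : ℂ) ^ 2)) =
      ((1 + t ^ 2 : ℝ) : ℂ) * (b / (1 - a * b * (t : ℂ) ^ 2)) := by push_cast; ring
    rw [this, im_ofReal_mul]; ring
  rw [e]
  refine ⟨hI.im.neg, ?_⟩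
  rw [integral_neg]
  congr 1
  have := integral_im hI
  rw [Em, ← integral_const_mul]
  exact this.symm

lemma Em_im_neg (G : Measure ℝ) [IsFiniteMeasure G] (hG : G ≠ 0) {a b : ℂ} (ha : a.im < 0)
    (hb : b.im < 0) : (b * Em G (a * b)).im < 0 := by
  obtain ⟨h1, h2⟩ := mulEm_im G ha hb
  have hpos : ∀ t : ℝ, 0 < (1 + t ^ 2) * -(b / (1 - a * b * (t : ℂ) ^ 2)).im := by
    intro t
    have hne := one_sub_ne (slit_mul ha hb) t
    have hN : 0 < normSq (1 - a * b * (t : ℂ) ^ 2) := normSq_pos.2 hne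
    have key : -(b / (1 - a * b * (t : ℂ) ^ 2)).im =
      (-b.im + normSq b * t ^ 2 * (-a.im)) / normSq (1 - a * b * (t : ℂ) ^ 2) := by
      rw [div_im]
      rw [← sub_div, ← neg_div]
      congr 1
      rw [normSq_apply]
      have e : ((t : ℂ) ^ 2) = ((t ^ 2 : ℝ) : ℂ) := by push_cast; rfl
      rw [e]
      simp only [sub_re, sub_im, mul_re, mul_im, ofReal_re, ofReal_im, one_re, one_im]
      ring
    rw [key]
    have : 0 ≤ normSq b * t ^ 2 * (-a.im) :=
      mul_nonneg (mul_nonneg (normSq_nonneg _) (sq_nonneg _)) (by linarith)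
    have : 0 < (-b.im + normSq b * t ^ 2 * (-a.im)) := by linarith
    positivity
  have : 0 < ∫ t : ℝ, (1 + t ^ 2) * -(b / (1 - a * b * (t : ℂ) ^ 2)).im ∂G := by
    rw [integral_pos_iff_support_of_nonneg (fun t => (hpos t).le) h1]
    have : Function.support (fun t : ℝ => (1 + t ^ 2) * -(b / (1 - a * b * (t : ℂ) ^ 2)).im) = univ := by
      ext t; simpa using (hpos t).ne'
    rw [this]
    exact (Measure.measure_univ_pos).2 hG
  linarith

/-- `-C(-r)` -/
def cneg (G : Measure ℝ) (r : ℝ) : ℝ := r * ∫ t : ℝ, (1 + t ^ 2) / (1 + r * t ^ 2) ∂G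

lemma cneg_integrable (G : Measure ℝ) [IsFiniteMeasure G] {r : ℝ} (hr : 0 < r) :
    Integrable (fun t : ℝ => (1 + t ^ 2) / (1 + r * t ^ 2)) G := by
  refine Integrable.of_bound (C := 1 + r⁻¹) (Measurable.aestronglyMeasurable (by fun_prop))
    (ae_of_all _ fun t => ?_)
  rw [Real.norm_of_nonneg (by positivity), div_le_iff₀ (by positivity)]
  have : (1 + r⁻¹) * (1 + r * t ^ 2) = 1 + r * t ^ 2 + r⁻¹ + t ^ 2 := by field_simp; ring
  rw [this]
  have h1 : 0 ≤ r * t ^ 2 := by positivity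
  have h2 : 0 < r⁻¹ := by positivity
  linarith

lemma rectC_neg (G : Measure ℝ) (r : ℝ) :
    rectC G ((-r : ℝ) : ℂ) = ((-cneg G r : ℝ) : ℂ) := by
  unfold rectC cneg
  have : ∫ t : ℝ, (1 + (t : ℂ) ^ 2) / (1 - ((-r : ℝ) : ℂ) * (t : ℂ) ^ 2) ∂G =
    ((∫ t : ℝ, (1 + t ^ 2) / (1 + r * t ^ 2) ∂G : ℝ) : ℂ) := by
    rw [← integral_complex_ofReal]
    congr 1; ext t; push_cast; ring
  rw [this]; push_cast; ring

lemma apriori0 (G : Measure ℝ) [IsFiniteMeasure G] (l : ℝ) (hl : l ∈ Set.Ioo (0 : ℝ) 1) {a b : ℂ}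
    (ha : a.im < 0) (hb : b.im < 0) {v1 v2 : ℝ} (h1 : 0 < v1) (h2 : 0 < v2)
    (hva : v1 * ‖a‖ ^ 2 ≤ -a.im) (hvb : v2 * ‖b‖ ^ 2 ≤ -b.im)
    (e1 : -(b * Em G (a * b)).im ≤ v1) (e2 : -(l * (a * Em G (a * b))).im ≤ v2) :
    2 * cneg G ‖a * b‖ ≤ 1 + 1 / l := by
  have hl0 := hl.1
  have hab : 0 < ‖a * b‖ := norm_pos_iff.2 (slit_ne0 (slit_mul ha hb))
  obtain ⟨i1, j1⟩ := mulEm_im G ha hb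
  obtain ⟨i2, j2⟩ := mulEm_im G hb ha
  rw [mul_comm b a] at i2 j2
  rw [im_ofReal_mul, ← mul_neg] at e2
  have e2' : -(a * Em G (a * b)).im ≤ v2 / l := by rw [le_div_iff₀ hl0]; linarith
  rw [j1] at e1
  rw [j2] at e2'
  have hle : 2 * cneg G ‖a * b‖ ≤
      (∫ t : ℝ, (1 + t ^ 2) * -(b / (1 - a * b * (t : ℂ) ^ 2)).im ∂G) / v1 +
      (∫ t : ℝ, (1 + t ^ 2) * -(a / (1 - a * b * (t : ℂ) ^ 2)).im ∂G) / v2 := by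
    rw [cneg, ← mul_assoc, ← integral_const_mul, ← integral_div, ← integral_div,
      ← integral_add (i1.div_const _) (i2.div_const _)]
    refine integral_mono ((cneg_integrable G hab).const_mul _)
      ((i1.div_const _).add (i2.div_const _)) fun t => ?_
    have := mul_le_mul_of_nonneg_left (pointwise_bd ha hb h1 h2 hva hvb t)
      (by positivity : 0 ≤ 1 + t ^ 2)
    calc _ = (1 + t ^ 2) * (2 * ‖a * b‖ / (1 + ‖a * b‖ * t ^ 2)) := by ring
      _ ≤ _ := this
      _ = _ := by ring
  refine hle.trans ?_
  have k1 := div_le_div_of_nonneg_right e1 h1.le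
  have k2 := div_le_div_of_nonneg_right e2' h2.le
  rw [div_self h1.ne'] at k1
  rw [div_right_comm, div_self h2.ne'] at k2
  linarith

def k2f (l : ℝ) (w k : ℂ) : ℂ := (l : ℂ) * k + (1 - l) / w
def B1f (l : ℝ) (G : Measure ℝ) (w k : ℂ) : ℂ := w - k2f l w k * Em G (k * k2f l w k)
def B2f (l : ℝ) (G : Measure ℝ) (w k : ℂ) : ℂ := w - (l : ℂ) * (k * Em G (k * k2f l w k))
def Phi (l : ℝ) (G ν : Measure ℝ) (w k : ℂ) : ℂ :=
  B2f l G w k * Dm ν (B1f l G w k * B2f l G w k) - k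

lemma k2f_im {l : ℝ} (hl : l ∈ Set.Ioo (0 : ℝ) 1) {w : ℂ} (k : ℂ) (hw : 0 ≤ w.im) :
    (k2f l w k).im ≤ l * k.im := by
  have e : k2f l w k = (l : ℂ) * k + ((1 - l : ℝ) : ℂ) * w⁻¹ := by
    unfold k2f; push_cast; ring
  rw [e, add_im, im_ofReal_mul, im_ofReal_mul, inv_im]
  have h1 : -w.im / normSq w ≤ 0 := div_nonpos_of_nonpos_of_nonneg (by linarith) (normSq_nonneg _)
  have h2 : 0 < 1 - l := by linarith [hl.2]
  nlinarith

lemma k2f_im' {l : ℝ} (hl : l ∈ Set.Ioo (0 : ℝ) 1) {w k : ℂ} (hw : 0 ≤ w.im) (hk : k.im < 0) :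
    (k2f l w k).im < 0 := by
  have := k2f_im hl k hw
  have h2 := mul_neg_of_pos_of_neg hl.1 hk
  linarith

lemma B1f_im {l : ℝ} (hl : l ∈ Set.Ioo (0 : ℝ) 1) (G : Measure ℝ) [IsFiniteMeasure G] (hG : G ≠ 0)
    {w k : ℂ} (hw : 0 ≤ w.im) (hk : k.im < 0) : 0 < (B1f l G w k).im := by
  have := Em_im_neg G hG hk (k2f_im' hl hw hk)
  rw [B1f, sub_im]; linarith

lemma B2f_im {l : ℝ} (hl : l ∈ Set.Ioo (0 : ℝ) 1) (G : Measure ℝ) [IsFiniteMeasure G] (hG : G ≠ 0)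
    {w k : ℂ} (hw : 0 ≤ w.im) (hk : k.im < 0) : 0 < (B2f l G w k).im := by
  have := Em_im_neg G hG (k2f_im' hl hw hk) hk
  rw [mul_comm (k2f l w k) k] at this
  rw [B2f, sub_im, im_ofReal_mul]
  have h2 := mul_neg_of_pos_of_neg hl.1 this
  linarith

lemma im_ne {k : ℂ} (h : 0 < k.im) : k ≠ 0 := by rintro rfl; simp at h

lemma Phi_diff {l : ℝ} (hl : l ∈ Set.Ioo (0 : ℝ) 1) (G ν : Measure ℝ) [IsFiniteMeasure G]
    [IsFiniteMeasure ν] (hG : G ≠ 0) {w k : ℂ} (hw : 0 ≤ w.im) (hw0 : w ≠ 0) (hk : k.im < 0) :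
    DifferentiableAt ℂ (fun p : ℂ × ℂ => Phi l G ν p.1 p.2) (w, k) := by
  have d1 : DifferentiableAt ℂ (fun p : ℂ × ℂ => p.1) (w, k) := differentiableAt_fst
  have d2 : DifferentiableAt ℂ (fun p : ℂ × ℂ => p.2) (w, k) := differentiableAt_snd
  have dk : DifferentiableAt ℂ (fun p : ℂ × ℂ => k2f l p.1 p.2) (w, k) := by
    unfold k2f
    have di : DifferentiableAt ℂ (fun p : ℂ × ℂ => p.1⁻¹) (w, k) :=
      DifferentiableAt.comp (g := fun x : ℂ => x⁻¹) (f := fun p : ℂ × ℂ => p.1) (w, k)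
        (differentiableAt_inv hw0) d1
    simp only [div_eq_mul_inv]
    exact (d2.const_mul _).add (di.const_mul _)
  have dh : DifferentiableAt ℂ (fun p : ℂ × ℂ => p.2 * k2f l p.1 p.2) (w, k) := d2.mul dk
  have dE : DifferentiableAt ℂ (fun p : ℂ × ℂ => Em G (p.2 * k2f l p.1 p.2)) (w, k) :=
    DifferentiableAt.comp (g := Em G) (w, k) (Em_diff G (slit_mul hk (k2f_im' hl hw hk))) dh
  have db1 : DifferentiableAt ℂ (fun p : ℂ × ℂ => B1f l G p.1 p.2) (w, k) := by
    unfold B1f; exact d1.sub (dk.mul dE)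
  have db2 : DifferentiableAt ℂ (fun p : ℂ × ℂ => B2f l G p.1 p.2) (w, k) := by
    unfold B2f; exact d1.sub ((d2.mul dE).const_mul _)
  have dD : DifferentiableAt ℂ (fun p : ℂ × ℂ => Dm ν (B1f l G p.1 p.2 * B2f l G p.1 p.2)) (w, k) :=
    DifferentiableAt.comp (g := Dm ν) (w, k)
      (Dm_diff ν (slit_mul' (B1f_im hl G hG hw hk) (B2f_im hl G hG hw hk))) (db1.mul db2)
  unfold Phi
  exact (db2.mul dD).sub d2

lemma apriori {l : ℝ} (hl : l ∈ Set.Ioo (0 : ℝ) 1) (G ν : Measure ℝ) [IsFiniteMeasure G]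
    [IsProbabilityMeasure ν] (hG : G ≠ 0) {w k : ℂ} (hw : 0 ≤ w.im) (hw0 : w ≠ 0) (hk : k.im < 0)
    (h : Phi l G ν w k = 0) : 2 * cneg G ‖k * k2f l w k‖ ≤ 1 + 1 / l := by
  have hb1 := B1f_im hl G hG hw hk
  have hb2 := B2f_im hl G hG hw hk
  have hA : B2f l G w k * Dm ν (B1f l G w k * B2f l G w k) = k := sub_eq_zero.1 h
  have hB : (l : ℂ) * (B1f l G w k * Dm ν (B2f l G w k * B1f l G w k)) + (1 - l) / B2f l G w k
      = k2f l w k := by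
    have e1 : B2f l G w k * k2f l w k = l * (B1f l G w k * k) + (1 - l) := by
      unfold B1f B2f
      have : w * k2f l w k = l * (w * k) + (1 - l) := by unfold k2f; field_simp
      linear_combination this
    have hne := im_ne hb2
    rw [mul_comm (B2f l G w k) (B1f l G w k)]
    apply mul_left_cancel₀ hne
    rw [e1, mul_add, mul_div_cancel₀ _ hne]
    linear_combination (l : ℂ) * B1f l G w k * hA
  refine apriori0 G l hl hk (k2f_im' hl hw hk) hb1 hb2 ?_ ?_ ?_ ?_
  · have := disc_int ν hb1 hb2
    rwa [hA] at this
  · have := disc_conv l hl hb2 (disc_int ν hb2 hb1)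
    rwa [hB] at this
  · rw [B1f, sub_im]; linarith
  · rw [B2f, sub_im]; linarith

def gr (ρ : Measure ℝ) (w : ℂ) : ℂ := w * Dm ρ (w * w)

lemma gr_im (ρ : Measure ℝ) [IsProbabilityMeasure ρ] {w : ℂ} (hw : 0 < w.im) : (gr ρ w).im < 0 := by
  have hne := fun t => slit_ne (slit_mul' hw hw) t
  have hintg := (Dm_integrable ρ (slit_mul' hw hw)).const_mul w
  have hpos : ∀ t : ℝ, 0 < -(w * (1 / (w * w - (t : ℂ) ^ 2))).im := by
    intro t
    rw [mul_one_div]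
    refine lt_of_lt_of_le ?_ (disc_point hw hw t)
    have : 0 < ‖w / (w * w - (t : ℂ) ^ 2)‖ := norm_pos_iff.2 (div_ne_zero (im_ne hw) (hne t))
    positivity
  have e : -(gr ρ w).im = ∫ t : ℝ, -(w * (1 / (w * w - (t : ℂ) ^ 2))).im ∂ρ := by
    rw [integral_neg, gr, Dm, ← integral_const_mul]
    congr 1
    exact (integral_im hintg).symm
  have : 0 < ∫ t : ℝ, -(w * (1 / (w * w - (t : ℂ) ^ 2))).im ∂ρ := by
    rw [integral_pos_iff_support_of_nonneg (fun t => (hpos t).le) hintg.im.neg]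
    have : Function.support (fun t : ℝ => -(w * (1 / (w * w - (t : ℂ) ^ 2))).im) = univ := by
      ext t
      simp only [Function.mem_support, mem_univ, iff_true]
      exact (hpos t).ne'
    rw [this]; simp
  linarith

lemma gr_diff (ρ : Measure ℝ) [IsProbabilityMeasure ρ] {w : ℂ} (hw : 0 < w.im) :
    DifferentiableAt ℂ (gr ρ) w := by
  have h1 : DifferentiableAt ℂ (fun w : ℂ => w * w) w := differentiableAt_id.mul differentiableAt_id
  exact differentiableAt_id.mul (DifferentiableAt.comp (g := Dm ρ) w (Dm_diff ρ (slit_mul' hw hw)) h1)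

lemma neg_slit {x : ℝ} (hx : x < 0) : -(x : ℂ) ∈ slitPlane := by
  rw [mem_slitPlane_iff]; left; simpa using hx

lemma Mt_eq (m : Measure ℝ) [IsProbabilityMeasure m] {z : ℂ} (hz : -z ∈ slitPlane) :
    Mt m z = -1 + z⁻¹ * Dm m z⁻¹ := by
  have h0 := slit_ne0 hz
  have e : ∀ t : ℝ, z * (t : ℂ) ^ 2 / (1 - z * (t : ℂ) ^ 2) = -1 + z⁻¹ * (1 / (z⁻¹ - (t : ℂ) ^ 2)) := by
    intro t
    have h1 := one_sub_ne hz t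
    have h2 := slit_ne (slit_inv hz) t
    have h3 : z⁻¹ * (1 / (z⁻¹ - (t : ℂ) ^ 2)) = 1 / (1 - z * (t : ℂ) ^ 2) := by
      rw [mul_one_div, div_eq_div_iff h2 h1]; field_simp
    rw [h3]; field_simp; ring
  unfold Mt
  simp_rw [e]
  rw [integral_add (integrable_const _) ((Dm_integrable m (slit_inv hz)).const_mul _),
    integral_const_mul, integral_const]
  simp [Dm]

lemma Dm_real (m : Measure ℝ) [IsProbabilityMeasure m] {x : ℝ} (hx : x < 0) :
    ∃ d : ℝ, 0 < d ∧ (x : ℂ) * Dm m (x : ℂ) = (d : ℂ) := by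
  have hintg := (Dm_integrable m (neg_slit hx)).re
  have e : ∀ t : ℝ, (1 / ((x : ℂ) - (t : ℂ) ^ 2)) = ((1 / (x - t ^ 2) : ℝ) : ℂ) := by
    intro t; push_cast; rfl
  refine ⟨x * ∫ t : ℝ, 1 / (x - t ^ 2) ∂m, ?_, ?_⟩
  · rw [← integral_const_mul]
    have hint2 : Integrable (fun t : ℝ => x * (1 / (x - t ^ 2))) m := by
      refine Integrable.const_mul (hintg.congr (ae_of_all _ fun t => ?_)) x
      change RCLike.re _ = _
      rw [e t]; exact ofReal_re _
    have hpos : ∀ t : ℝ, 0 < x * (1 / (x - t ^ 2)) := by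
      intro t
      rw [mul_one_div]
      exact div_pos_of_neg_of_neg hx (by nlinarith [sq_nonneg t])
    rw [integral_pos_iff_support_of_nonneg (fun t => (hpos t).le) hint2]
    have : Function.support (fun t : ℝ => x * (1 / (x - t ^ 2))) = univ := by
      ext t
      simp only [Function.mem_support, mem_univ, iff_true]
      exact (hpos t).ne'
    rw [this]; simp
  · unfold Dm
    simp_rw [e]
    rw [integral_complex_ofReal]
    push_cast; rfl

lemma cneg_nonneg (G : Measure ℝ) {r : ℝ} (hr : 0 ≤ r) : 0 ≤ cneg G r :=
  mul_nonneg hr (integral_nonneg fun t => by positivity)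

lemma Phi_imag {l : ℝ} (hl : l ∈ Set.Ioo (0 : ℝ) 1) (G ν ρ : Measure ℝ) [IsFiniteMeasure G]
    [IsProbabilityMeasure ν] [IsProbabilityMeasure ρ] (hG : G ≠ 0) {w : ℂ} {x : ℝ} (hx : x < 0)
    (hw : 0 < w.im) (hwx : w * w = (x : ℂ)⁻¹)
    (hc : Ht l ρ (x : ℂ) =
      Ht l ν (Ht l ρ (x : ℂ) / Tfun l (Mt ρ (x : ℂ) - rectC G (Ht l ρ (x : ℂ))))) :
    Phi l G ν w (gr ρ w) = 0 := by
  have hl0 := hl.1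
  have hl1 := hl.2
  have hxc : (x : ℂ) ≠ 0 := by exact_mod_cast hx.ne
  have hw0 := im_ne hw
  obtain ⟨p, hp, hpe⟩ := Dm_real ρ (x := x⁻¹) (inv_lt_zero.2 hx)
  rw [ofReal_inv] at hpe
  have hM : Mt ρ (x : ℂ) = -1 + p := by rw [Mt_eq ρ (neg_slit hx), hpe]
  obtain ⟨η, hη⟩ : ∃ η : ℝ, η = x * p * (1 - l + l * p) := ⟨_, rfl⟩
  have hη0 : η < 0 := by
    rw [hη]
    have : 0 < 1 - l + l * p := by nlinarith
    have h2 : x * p < 0 := mul_neg_of_neg_of_pos hx hp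
    exact mul_neg_of_neg_of_pos h2 this
  have hH : Ht l ρ (x : ℂ) = (η : ℂ) := by
    rw [Ht, hM, hη]; push_cast; ring
  obtain ⟨c, hcdef⟩ : ∃ c, c = cneg G (-η) := ⟨_, rfl⟩
  have hc0 : 0 ≤ c := hcdef ▸ cneg_nonneg G (by linarith)
  have hC : rectC G (η : ℂ) = -(c : ℂ) := by
    have := rectC_neg G (-η)
    rw [neg_neg] at this
    rw [this, hcdef]; push_cast; rfl
  obtain ⟨q, hq⟩ : ∃ q, q = p + c := ⟨_, rfl⟩
  have hq0 : 0 < q := by linarith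
  obtain ⟨τ, hτ⟩ : ∃ τ, τ = (1 - l + l * q) * q := ⟨_, rfl⟩
  have hτ0 : 0 < τ := by
    rw [hτ]
    have : 0 < 1 - l + l * q := by nlinarith
    positivity
  have hT : Tfun l (Mt ρ (x : ℂ) - rectC G (η : ℂ)) = (τ : ℂ) := by
    rw [hM, hC, Tfun, hτ, hq]; push_cast; ring
  rw [hH, hT] at hc
  have hω0 : η / τ < 0 := div_neg_of_neg_of_pos hη0 hτ0
  obtain ⟨p', hp', hpe'⟩ := Dm_real ν (x := (η / τ)⁻¹) (inv_lt_zero.2 hω0)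
  have hM' : Mt ν ((η / τ : ℝ) : ℂ) = -1 + p' := by
    rw [Mt_eq ν (neg_slit hω0)]
    rw [ofReal_inv] at hpe'
    rw [hpe']
  have hH' : η = η / τ * p' * (1 - l + l * p') := by
    have : (η : ℂ) = ((η / τ * p' * (1 - l + l * p') : ℝ) : ℂ) := by
      rw [hc, ← ofReal_div, Ht, hM']; push_cast; ring
    exact_mod_cast this
  have hpq : p' = q := by
    have h1 : p' * (1 - l + l * p') = (1 - l + l * q) * q := by
      have : η * (p' * (1 - l + l * p')) = η * τ := by
        field_simp at hH'
        linear_combination -hH'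
      rw [← hτ]
      exact mul_left_cancel₀ hη0.ne this
    have h2 : (p' - q) * (1 - l + l * (p' + q)) = 0 := by linear_combination h1
    have h3 : 0 < 1 - l + l * (p' + q) := by
      have : 0 < l * (p' + q) := by positivity
      linarith
    rcases mul_eq_zero.1 h2 with h | h
    · linarith
    · linarith
  -- now complex algebra
  have hg : gr ρ w * w = p := by
    rw [gr, hwx, ← hpe, ← hwx]; ring
  have hk : k2f l w (gr ρ w) * w = l * p + (1 - l) := by
    rw [k2f, add_mul, mul_assoc, hg, div_mul_cancel₀ _ hw0]
  have hgk : gr ρ w * k2f l w (gr ρ w) = (η : ℂ) := by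
    have hww : w * w ≠ 0 := mul_ne_zero hw0 hw0
    apply mul_right_cancel₀ hww
    have h1 : (η : ℂ) * (w * w) = p * (1 - l + l * p) := by
      rw [hwx, hη]; push_cast; field_simp
    rw [h1]
    linear_combination k2f l w (gr ρ w) * w * hg + p * hk
  have hCE : (η : ℂ) * Em G (η : ℂ) = -(c : ℂ) := by rw [← hC]; rfl
  have hb1 : B1f l G w (gr ρ w) * gr ρ w = q := by
    rw [B1f, hgk, hq]; push_cast
    linear_combination hg - Em G (η : ℂ) * hgk - hCE
  have hb2 : B2f l G w (gr ρ w) * k2f l w (gr ρ w) = 1 - l + l * q := by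
    rw [B2f, hgk, hq]; push_cast
    linear_combination hk - l * Em G (η : ℂ) * hgk - l * hCE
  have hηc : (η : ℂ) ≠ 0 := by exact_mod_cast hη0.ne
  have hτc : (τ : ℂ) ≠ 0 := by exact_mod_cast hτ0.ne'
  have hbb : B1f l G w (gr ρ w) * B2f l G w (gr ρ w) = (((η / τ)⁻¹ : ℝ) : ℂ) := by
    apply mul_right_cancel₀ hηc
    have : (((η / τ)⁻¹ : ℝ) : ℂ) * η = τ := by push_cast; field_simp
    rw [this, ← hgk, hτ]; push_cast
    linear_combination B2f l G w (gr ρ w) * k2f l w (gr ρ w) * hb1 + q * hb2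
  rw [← hbb, hpq] at hpe'
  have hB1 := im_ne (B1f_im hl G hG hw.le (gr_im ρ hw))
  rw [Phi]
  apply mul_left_cancel₀ hB1
  linear_combination hpe' - hb1

lemma Phi_gr {l : ℝ} (hl : l ∈ Set.Ioo (0 : ℝ) 1) (G ν ρ : Measure ℝ) [IsFiniteMeasure G]
    [IsProbabilityMeasure ν] [IsProbabilityMeasure ρ] (hG : G ≠ 0) (hconv : IsRectConv l G ν ρ) :
    ∀ w : ℂ, 0 < w.im → Phi l G ν w (gr ρ w) = 0 := by
  obtain ⟨ε, hε, hc⟩ := hconv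
  have hopen : IsOpen {w : ℂ | 0 < w.im} := isOpen_lt continuous_const continuous_im
  have hd : DifferentiableOn ℂ (fun w => Phi l G ν w (gr ρ w)) {w : ℂ | 0 < w.im} := by
    intro w hw
    have h1 : DifferentiableAt ℂ (fun w => (w, gr ρ w)) w := differentiableAt_id.prodMk (gr_diff ρ hw)
    have h2 : DifferentiableAt ℂ (fun p : ℂ × ℂ => Phi l G ν p.1 p.2) (w, gr ρ w) :=
      Phi_diff hl G ν hG (le_of_lt hw) (im_ne hw) (gr_im ρ hw)
    exact (DifferentiableAt.comp (f := fun w => (w, gr ρ w)) w h2 h1).differentiableWithinAt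
  have hconn : IsPreconnected {w : ℂ | 0 < w.im} := (convex_halfSpace_im_gt 0).isPreconnected
  have hsq : 0 < √ε := Real.sqrt_pos.2 hε
  set Y : ℝ := 1 / √ε + 1
  have hY : 0 < Y := by positivity
  have hval : ∀ y : ℝ, 1 / √ε < y → Phi l G ν (y * I) (gr ρ (y * I)) = 0 := by
    intro y hy
    have hy0 : 0 < y := lt_trans (by positivity) hy
    have hx : -(1 / y ^ 2) < 0 := by
      have : 0 < 1 / y ^ 2 := by positivity
      linarith
    refine Phi_imag hl G ν ρ hG (x := -(1 / y ^ 2)) hx (by simpa using hy0) ?_ ?_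
    · push_cast
      rw [inv_neg, one_div, inv_inv]
      linear_combination (y : ℂ) ^ 2 * I_mul_I
    · refine (hc _ ⟨?_, hx⟩).2
      have : 1 < y * √ε := by rwa [div_lt_iff₀ hsq] at hy
      have h2 : 1 < y ^ 2 * ε := by
        have h3 : (y * √ε) ^ 2 = y ^ 2 * ε := by rw [mul_pow, Real.sq_sqrt hε.le]
        rw [← h3]; nlinarith
      rw [neg_lt_neg_iff, div_lt_iff₀ (by positivity)]
      linarith
  have hfreq : ∃ᶠ w in 𝓝[≠] ((Y : ℂ) * I), Phi l G ν w (gr ρ w) = 0 := by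
    have ht : Tendsto (fun y : ℝ => (y : ℂ) * I) (𝓝[≠] Y) (𝓝[≠] ((Y : ℂ) * I)) := by
      refine tendsto_nhdsWithin_iff.2 ⟨?_, ?_⟩
      · exact (Continuous.tendsto (by fun_prop) Y).mono_left nhdsWithin_le_nhds
      · filter_upwards [self_mem_nhdsWithin] with y hy
        intro h
        apply hy
        have := mul_right_cancel₀ I_ne_zero h
        exact_mod_cast this
    refine ht.frequently (Eventually.frequently ?_)
    refine Filter.Eventually.filter_mono nhdsWithin_le_nhds ?_
    filter_upwards [lt_mem_nhds (show 1 / √ε < Y by simp [Y])] with y hy using hval y hy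
  have := AnalyticOnNhd.eqOn_of_preconnected_of_frequently_eq (hd.analyticOnNhd hopen)
    (analyticOnNhd_const (v := (0 : ℂ))) hconn (z₀ := (Y : ℂ) * I) (by simpa using hY) hfreq
  exact fun w hw => this hw

lemma cneg_large (G : Measure ℝ)
    (hC2 : ∃ L : EReal, L ≤ 0 ∧ L ≠ 0 ∧
      Tendsto (fun x : ℝ => (((rectC G (x : ℂ)) ^ 2 / (x : ℂ)).re : EReal)) atBot
        (nhds L)) (K : ℝ) : ∃ R : ℝ, 0 < R ∧ ∀ r, R < r → K < cneg G r := by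
  obtain ⟨L, h1, h2, h3⟩ := hC2
  obtain ⟨c, hc1, hc2⟩ := EReal.lt_iff_exists_real_btwn.1 (lt_of_le_of_ne h1 h2)
  have hc0 : c < 0 := by exact_mod_cast hc2
  have hev := h3.eventually (gt_mem_nhds hc1)
  obtain ⟨b, hb⟩ := eventually_atBot.1 hev
  refine ⟨max (max 1 (-b)) (K ^ 2 / (-c)), by positivity, fun r hr => ?_⟩
  have hr1 : 1 < r := lt_of_le_of_lt ((le_max_left _ _).trans (le_max_left _ _)) hr
  have hr2 : -b < r := lt_of_le_of_lt ((le_max_right _ _).trans (le_max_left _ _)) hr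
  have hr3 : K ^ 2 / (-c) < r := lt_of_le_of_lt (le_max_right _ _) hr
  have := hb (-r) (by linarith)
  rw [rectC_neg] at this
  have e : (((-cneg G r : ℝ) : ℂ) ^ 2 / ((-r : ℝ) : ℂ)) = (((-cneg G r) ^ 2 / (-r) : ℝ) : ℂ) := by
    push_cast; rfl
  rw [e, ofReal_re] at this
  have h4 : (-cneg G r) ^ 2 / (-r) < c := by exact_mod_cast this
  rw [div_lt_iff_of_neg (by linarith)] at h4
  rw [div_lt_iff₀ (by linarith)] at hr3
  have h5 : K ^ 2 < (cneg G r) ^ 2 := by nlinarith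
  exact lt_of_pow_lt_pow_left₀ 2 (cneg_nonneg G (by linarith)) h5

lemma no_ident {l : ℝ} (hl : l ∈ Set.Ioo (0 : ℝ) 1) (G ν : Measure ℝ) [IsFiniteMeasure G]
    [IsProbabilityMeasure ν] (hG : G ≠ 0) {R : ℝ} (hR : 0 < R)
    (hRb : ∀ r, R < r → (1 + 1 / l) / 2 < cneg G r) {w : ℂ} (hw : 0 ≤ w.im) (hw0 : w ≠ 0)
    (h : ∀ k : ℂ, k.im < 0 → Phi l G ν w k = 0) : False := by
  have hl0 := hl.1
  obtain ⟨q, hq⟩ : ∃ q : ℝ, q = R / l + 1 := ⟨_, rfl⟩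
  have hdiv : 0 < R / l := by positivity
  have hq1 : 1 < q := by linarith
  have hk : (-(q : ℂ) * I).im < 0 := by simp; linarith
  have h1 := apriori hl G ν hG hw hw0 hk (h _ hk)
  have h2 := k2f_im hl (-(q : ℂ) * I) hw
  have h3 : (-(q : ℂ) * I).im = -q := by simp
  have h4 : ‖-(q : ℂ) * I‖ = q := by
    rw [norm_mul, norm_neg, norm_I, mul_one, norm_real, Real.norm_of_nonneg (by linarith)]
  have h5 : l * q ≤ ‖k2f l w (-(q : ℂ) * I)‖ := by
    have := abs_im_le_norm (k2f l w (-(q : ℂ) * I))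
    rw [h3] at h2
    have := neg_abs_le (k2f l w (-(q : ℂ) * I)).im
    linarith
  have h6 : R < ‖(-(q : ℂ) * I) * k2f l w (-(q : ℂ) * I)‖ := by
    rw [norm_mul, h4]
    have : l * q = R + l := by rw [hq]; field_simp
    nlinarith
  have := hRb _ h6
  linarith

lemma h_bd {l : ℝ} (hl : l ∈ Set.Ioo (0 : ℝ) 1) (G ν ρ : Measure ℝ) [IsFiniteMeasure G]
    [IsProbabilityMeasure ν] [IsProbabilityMeasure ρ] (hG : G ≠ 0) {R : ℝ}
    (hRb : ∀ r, R < r → (1 + 1 / l) / 2 < cneg G r)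
    (hP : ∀ w : ℂ, 0 < w.im → Phi l G ν w (gr ρ w) = 0) {w : ℂ} (hw : 0 < w.im) :
    ‖gr ρ w * k2f l w (gr ρ w)‖ ≤ R := by
  by_contra! hlt
  have h1 := apriori hl G ν hG hw.le (im_ne hw) (gr_im ρ hw) (hP w hw)
  have := hRb _ hlt
  linarith

lemma gr_cont (ρ : Measure ℝ) [IsProbabilityMeasure ρ] : ContinuousOn (gr ρ) {w : ℂ | 0 < w.im} :=
  fun _ hw => (gr_diff ρ hw).continuousAt.continuousWithinAt

lemma half_conn (z : ℂ) (δ : ℝ) : IsPreconnected ({w : ℂ | 0 < w.im} ∩ Metric.ball z δ) :=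
  ((convex_halfSpace_im_gt 0).inter (convex_ball z δ)).isPreconnected

lemma lim_zero {l : ℝ} (hl : l ∈ Set.Ioo (0 : ℝ) 1) (ρ : Measure ℝ) [IsProbabilityMeasure ρ] {R : ℝ}
    (hR : 0 < R)
    (hb : ∀ w : ℂ, 0 < w.im → ‖gr ρ w * k2f l w (gr ρ w)‖ ≤ R) :
    Tendsto (fun w => (gr ρ w).im) (𝓝[{w : ℂ | 0 < w.im}] 0) (𝓝 0) := by
  have hl0 := hl.1
  have hl1 : 0 < 1 - l := by linarith [hl.2]
  -- u = w g
  have hu : ∀ w : ℂ, 0 < w.im → ‖w * gr ρ w‖ * ‖(l : ℂ) * (w * gr ρ w) + (1 - l)‖ ≤ R * ‖w‖ ^ 2 := by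
    intro w hw
    have hw0 := im_ne hw
    have e : (w * gr ρ w) * ((l : ℂ) * (w * gr ρ w) + (1 - l)) =
        (gr ρ w * k2f l w (gr ρ w)) * w ^ 2 := by
      unfold k2f; field_simp
    rw [← norm_mul, e, norm_mul, norm_pow]
    exact mul_le_mul_of_nonneg_right (hb w hw) (by positivity)
  obtain ⟨κ, hκ⟩ : ∃ κ : ℝ, κ = (1 - l) / 2 := ⟨_, rfl⟩
  have hκ0 : 0 < κ := by rw [hκ]; linarith
  obtain ⟨δ, hδ⟩ : ∃ δ : ℝ, δ = √(κ ^ 2 / (l * R)) := ⟨_, rfl⟩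
  have hδ0 : 0 < δ := by rw [hδ]; exact Real.sqrt_pos.2 (by positivity)
  have hδ2 : l * (R * δ ^ 2) = κ ^ 2 := by
    rw [hδ, Real.sq_sqrt (by positivity)]; field_simp
  -- real part avoids -κ / l
  have hne : ∀ w ∈ {w : ℂ | 0 < w.im} ∩ Metric.ball 0 δ, l * (w * gr ρ w).re ≠ -κ := by
    rintro w ⟨hw, hwδ⟩ he
    have hwδ' : ‖w‖ < δ := by simpa using hwδ
    have h1 := hu w hw
    have h2 : κ ≤ l * ‖w * gr ρ w‖ := by
      have := neg_abs_le (w * gr ρ w).re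
      have h3 := abs_re_le_norm (w * gr ρ w)
      nlinarith
    have h3 : κ ≤ ‖(l : ℂ) * (w * gr ρ w) + (1 - l)‖ := by
      refine le_trans ?_ ((le_abs_self _).trans (abs_re_le_norm _))
      rw [add_re, re_ofReal_mul, he]
      simp only [sub_re, one_re, ofReal_re]
      linarith
    have h4 : κ * κ ≤ (l * ‖w * gr ρ w‖) * ‖(l : ℂ) * (w * gr ρ w) + (1 - l)‖ :=
      mul_le_mul h2 h3 hκ0.le (by positivity)
    have h5 : ‖w‖ ^ 2 < δ ^ 2 := by gcongr
    have h6 : l * (R * ‖w‖ ^ 2) < l * (R * δ ^ 2) := by gcongr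
    nlinarith
  have hcont : ContinuousOn (fun w : ℂ => l * (w * gr ρ w).re) ({w : ℂ | 0 < w.im} ∩ Metric.ball 0 δ) := by
    have := (gr_cont ρ).mono (inter_subset_left (s := {w : ℂ | 0 < w.im}) (t := Metric.ball 0 δ))
    exact continuousOn_const.mul (continuous_re.comp_continuousOn (continuousOn_id.mul this))
  have hbase : ∃ w ∈ {w : ℂ | 0 < w.im} ∩ Metric.ball (0 : ℂ) δ, -κ < l * (w * gr ρ w).re := by
    refine ⟨(δ / 2 : ℝ) * I, ⟨by simpa using hδ0, ?_⟩, ?_⟩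
    · simp [abs_of_pos hδ0]; linarith
    · obtain ⟨d, hd, he⟩ := Dm_real ρ (x := -(δ / 2) ^ 2) (by nlinarith)
      have e : ((δ / 2 : ℝ) : ℂ) * I * gr ρ ((δ / 2 : ℝ) * I) = d := by
        rw [gr, ← mul_assoc]
        have : ((δ / 2 : ℝ) : ℂ) * I * (((δ / 2 : ℝ) : ℂ) * I) = ((-(δ / 2) ^ 2 : ℝ) : ℂ) := by
          push_cast; linear_combination ((δ : ℂ) / 2) ^ 2 * I_mul_I
        rw [this, he]
      rw [e, ofReal_re]
      have : 0 < l * d := by positivity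
      linarith
  have hall : ∀ w ∈ {w : ℂ | 0 < w.im} ∩ Metric.ball (0 : ℂ) δ, -κ < l * (w * gr ρ w).re := by
    intro w hw
    by_contra! hle
    obtain ⟨w1, hw1, hlt⟩ := hbase
    obtain ⟨w2, hw2, he⟩ := (half_conn 0 δ).intermediate_value hw hw1 hcont ⟨hle, hlt.le⟩
    exact hne w2 hw2 he
  have hfin : ∀ w ∈ {w : ℂ | 0 < w.im} ∩ Metric.ball (0 : ℂ) δ, ‖(gr ρ w).im‖ ≤ R / κ * ‖w‖ := by
    intro w hw
    have h1 := hu w hw.1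
    have h2 := hall w hw
    have hwp : 0 < ‖w‖ := norm_pos_iff.2 (im_ne hw.1)
    have h3 : κ ≤ ‖(l : ℂ) * (w * gr ρ w) + (1 - l)‖ := by
      refine le_trans ?_ ((le_abs_self _).trans (abs_re_le_norm _))
      rw [add_re, re_ofReal_mul]
      simp only [sub_re, one_re, ofReal_re]
      linarith
    have h4 : ‖w * gr ρ w‖ * κ ≤ R * ‖w‖ ^ 2 :=
      (mul_le_mul_of_nonneg_left h3 (norm_nonneg _)).trans h1
    rw [norm_mul] at h4
    have h5 : ‖gr ρ w‖ * κ ≤ R * ‖w‖ := by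
      have : ‖w‖ * (‖gr ρ w‖ * κ) ≤ ‖w‖ * (R * ‖w‖) := by nlinarith
      exact le_of_mul_le_mul_left this hwp
    refine (abs_im_le_norm _).trans ?_
    rw [div_mul_eq_mul_div, le_div_iff₀ hκ0]
    exact h5
  have hz : Tendsto (fun w : ℂ => R / κ * ‖w‖) (𝓝[{w : ℂ | 0 < w.im}] 0) (𝓝 0) := by
    have : Tendsto (fun w : ℂ => R / κ * ‖w‖) (𝓝 0) (𝓝 (R / κ * ‖(0 : ℂ)‖)) :=
      Continuous.tendsto (by fun_prop) 0
    rw [norm_zero, mul_zero] at this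
    exact this.mono_left nhdsWithin_le_nhds
  refine squeeze_zero_norm' ?_ hz
  filter_upwards [inter_mem self_mem_nhdsWithin
    (mem_nhdsWithin_of_mem_nhds (Metric.ball_mem_nhds (0 : ℂ) hδ0))] with w hw using hfin w hw

lemma cluster_zero {l : ℝ} (hl : l ∈ Set.Ioo (0 : ℝ) 1) (G ν ρ : Measure ℝ) [IsFiniteMeasure G]
    [IsProbabilityMeasure ν] [IsProbabilityMeasure ρ] (hG : G ≠ 0)
    (hP : ∀ w : ℂ, 0 < w.im → Phi l G ν w (gr ρ w) = 0) {w0 k : ℂ} (hw : 0 ≤ w0.im) (hw0 : w0 ≠ 0)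
    (hk : k.im < 0) (hc : MapClusterPt k (𝓝[{w : ℂ | 0 < w.im}] w0) (gr ρ)) :
    Phi l G ν w0 k = 0 := by
  obtain ⟨U, hU, hUt⟩ := mapClusterPt_iff_ultrafilter.1 hc
  have h1 : Tendsto (fun w : ℂ => w) U (𝓝 w0) := hU.trans nhdsWithin_le_nhds
  have h2 : Tendsto (fun w : ℂ => (w, gr ρ w)) U (𝓝 (w0, k)) := h1.prodMk_nhds hUt
  have h3 := (Phi_diff hl G ν hG hw hw0 hk).continuousAt.tendsto.comp h2
  have h4 : ∀ᶠ w in (U : Filter ℂ), Phi l G ν w (gr ρ w) = 0 :=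
    hU (by filter_upwards [self_mem_nhdsWithin] with w hw using hP w hw)
  have h5 : Tendsto (fun _ : ℂ => (0 : ℂ)) U (𝓝 (Phi l G ν w0 k)) :=
    h3.congr' (h4.mono fun w hw => hw)
  exact (tendsto_nhds_unique h5 tendsto_const_nhds)

lemma lim_ne {l : ℝ} (hl : l ∈ Set.Ioo (0 : ℝ) 1) (G ν ρ : Measure ℝ) [IsFiniteMeasure G]
    [IsProbabilityMeasure ν] [IsProbabilityMeasure ρ] (hG : G ≠ 0) {R : ℝ} (hR : 0 < R)
    (hRb : ∀ r, R < r → (1 + 1 / l) / 2 < cneg G r)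
    (hP : ∀ w : ℂ, 0 < w.im → Phi l G ν w (gr ρ w) = 0) {w0 : ℂ} (hw : 0 ≤ w0.im) (hw0 : w0 ≠ 0) :
    ∃ c : ℝ, Tendsto (fun w => (gr ρ w).im) (𝓝[{w : ℂ | 0 < w.im}] w0) (𝓝 c) := by
  have hl0 := hl.1
  have hl1 : 0 < 1 - l := by linarith [hl.2]
  by_cases hex : ∃ k : ℂ, k.im < 0 ∧ MapClusterPt k (𝓝[{w : ℂ | 0 < w.im}] w0) (gr ρ)
  · obtain ⟨k, hk, hkc⟩ := hex
    refine ⟨k.im, (continuous_im.tendsto k).comp ?_⟩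
    have hopen : IsOpen {k : ℂ | k.im < 0} := isOpen_lt continuous_im continuous_const
    have hd : DifferentiableOn ℂ (fun k => Phi l G ν w0 k) {k : ℂ | k.im < 0} := by
      intro k hk
      have h1 : DifferentiableAt ℂ (fun k : ℂ => (w0, k)) k :=
        (differentiableAt_const _).prodMk differentiableAt_id
      have h2 : DifferentiableAt ℂ (fun p : ℂ × ℂ => Phi l G ν p.1 p.2) (w0, k) :=
        Phi_diff hl G ν hG hw hw0 hk
      exact (DifferentiableAt.comp (f := fun k : ℂ => (w0, k)) k h2 h1).differentiableWithinAt
    have han := hd.analyticOnNhd hopen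
    rcases (han k hk).eventually_eq_zero_or_eventually_ne_zero with hz | hz
    · exfalso
      have hconn : IsPreconnected {w : ℂ | w.im < 0} := (convex_halfSpace_im_lt 0).isPreconnected
      have := AnalyticOnNhd.eqOn_zero_of_preconnected_of_eventuallyEq_zero han hconn hk hz
      exact no_ident hl G ν hG hR hRb hw hw0 fun k hk => this hk
    · rw [eventually_nhdsWithin_iff, Metric.eventually_nhds_iff] at hz
      obtain ⟨r0, hr0, hz⟩ := hz
      rw [Metric.tendsto_nhds]
      intro ε hε
      obtain ⟨r, hr, hrε, hrr, hrk⟩ : ∃ r > 0, r ≤ ε ∧ r < r0 ∧ r < -k.im := by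
        refine ⟨min ε (min (r0 / 2) (-k.im / 2)), ?_, min_le_left _ _, ?_, ?_⟩
        · refine lt_min hε (lt_min (by linarith) (by linarith))
        · have := (min_le_right ε (min (r0 / 2) (-k.im / 2))).trans (min_le_left _ _); linarith
        · have := (min_le_right ε (min (r0 / 2) (-k.im / 2))).trans (min_le_right _ _); linarith
      suffices h : ∀ᶠ w in 𝓝[{w : ℂ | 0 < w.im}] w0, dist (gr ρ w) k < r from
        h.mono fun w hw => hw.trans_le hrε
      by_contra hcon
      have hf1 : ∃ᶠ w in 𝓝[{w : ℂ | 0 < w.im}] w0, r ≤ dist (gr ρ w) k := by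
        intro h; apply hcon; filter_upwards [h] with w hw using not_le.1 hw
      have hf2 : ∃ᶠ w in 𝓝[{w : ℂ | 0 < w.im}] w0, dist (gr ρ w) k < r :=
        hkc.frequently (Metric.ball_mem_nhds k hr)
      have hf3 : ∃ᶠ w in 𝓝[{w : ℂ | 0 < w.im}] w0, gr ρ w ∈ Metric.sphere k r := by
        rw [frequently_iff]
        intro S hS
        obtain ⟨δ, hδ, hsub⟩ := Metric.mem_nhdsWithin_iff.1 hS
        have hmem : {w : ℂ | 0 < w.im} ∩ Metric.ball w0 δ ∈ 𝓝[{w : ℂ | 0 < w.im}] w0 :=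
          inter_mem self_mem_nhdsWithin (mem_nhdsWithin_of_mem_nhds (Metric.ball_mem_nhds w0 hδ))
        obtain ⟨a, ha, ha'⟩ := (frequently_iff.1 hf1) hmem
        obtain ⟨b, hb, hb'⟩ := (frequently_iff.1 hf2) hmem
        have hgc : ContinuousOn (gr ρ) ({w : ℂ | 0 < w.im} ∩ Metric.ball w0 δ) :=
          (gr_cont ρ).mono inter_subset_left
        have hcont : ContinuousOn (fun w => dist (gr ρ w) k) ({w : ℂ | 0 < w.im} ∩ Metric.ball w0 δ) :=
          (show Continuous fun z : ℂ => dist z k by fun_prop).comp_continuousOn hgc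
        obtain ⟨c, hc, hc'⟩ := (half_conn w0 δ).intermediate_value hb ha hcont ⟨hb'.le, ha'⟩
        exact ⟨c, hsub ⟨hc.2, hc.1⟩, hc'⟩
      obtain ⟨a, ha, hac⟩ := (isCompact_sphere k r).exists_mapClusterPt_of_frequently hf3
      have had : dist a k = r := ha
      have haim : a.im < 0 := by
        have h1 := abs_im_le_norm (a - k)
        rw [← dist_eq_norm, had, sub_im] at h1
        have := le_abs_self (a.im - k.im)
        linarith
      have h0 := cluster_zero hl G ν ρ hG hP hw hw0 haim hac
      refine hz (y := a) (by rw [had]; exact hrr) ?_ h0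
      rintro rfl
      rw [dist_self] at had; linarith
  · push Not at hex
    refine ⟨0, ?_⟩
    -- boundedness
    obtain ⟨S, hS⟩ : ∃ S : ℝ, S = 2 / ‖w0‖ := ⟨_, rfl⟩
    have hwn : 0 < ‖w0‖ := norm_pos_iff.2 hw0
    have hS0 : 0 < S := by rw [hS]; positivity
    obtain ⟨Q, hQ⟩ : ∃ Q : ℝ, Q = (R + S) / l + 1 := ⟨_, rfl⟩
    have hbd : ∀ᶠ w in 𝓝[{w : ℂ | 0 < w.im}] w0, ‖gr ρ w‖ ≤ Q := by
      filter_upwards [self_mem_nhdsWithin, mem_nhdsWithin_of_mem_nhds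
        (Metric.ball_mem_nhds w0 (half_pos hwn))] with w hwi hwb
      have hwi' : 0 < w.im := hwi
      have h1 := h_bd hl G ν ρ hG hRb hP hwi'
      have hwlow : ‖w0‖ / 2 ≤ ‖w‖ := by
        rw [Metric.mem_ball, dist_eq_norm, norm_sub_rev] at hwb
        have := norm_sub_norm_le w0 w
        linarith
      have h2 : ‖(1 - (l : ℂ)) / w‖ ≤ S := by
        rw [norm_div]
        have e : ‖(1 - (l : ℂ))‖ = 1 - l := by
          rw [← ofReal_one, ← ofReal_sub, norm_real, Real.norm_of_nonneg hl1.le]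
        rw [e, div_le_iff₀ (by linarith), hS]
        have : 1 ≤ 2 / ‖w0‖ * ‖w‖ := by
          rw [div_mul_eq_mul_div, le_div_iff₀ hwn]; linarith
        linarith
      have h3 : l * ‖gr ρ w‖ - S ≤ ‖k2f l w (gr ρ w)‖ := by
        have e : (l : ℂ) * gr ρ w = k2f l w (gr ρ w) - (1 - l) / w := by unfold k2f; ring
        have h4 := norm_sub_le (k2f l w (gr ρ w)) ((1 - (l : ℂ)) / w)
        rw [← e, norm_mul, norm_real, Real.norm_of_nonneg hl0.le] at h4
        linarith
      rw [norm_mul] at h1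
      by_contra! hlt
      have h5 : R + S + l < l * ‖gr ρ w‖ := by
        have : l * Q = R + S + l := by rw [hQ]; field_simp
        nlinarith
      have hQ1 : 1 ≤ Q := by
        have : 0 < (R + S) / l := by positivity
        linarith
      nlinarith [mul_le_mul_of_nonneg_left h3 (norm_nonneg (gr ρ w))]
    rw [Metric.tendsto_nhds]
    intro ε hε
    by_contra hcon
    have hf : ∃ᶠ w in 𝓝[{w : ℂ | 0 < w.im}] w0, gr ρ w ∈ Metric.closedBall 0 Q ∩ {k : ℂ | k.im ≤ -ε} := by
      have h1 : ∃ᶠ w in 𝓝[{w : ℂ | 0 < w.im}] w0, ¬ dist (gr ρ w).im 0 < ε := Filter.not_eventually.1 hcon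
      refine (h1.and_eventually (hbd.and self_mem_nhdsWithin)).mono ?_
      rintro w ⟨ha, hb, hc⟩
      refine ⟨by simpa using hb, ?_⟩
      have hneg := gr_im ρ hc
      rw [Real.dist_eq, sub_zero, abs_of_neg hneg] at ha
      show (gr ρ w).im ≤ -ε
      linarith
    have hcomp : IsCompact (Metric.closedBall (0 : ℂ) Q ∩ {k : ℂ | k.im ≤ -ε}) :=
      (isCompact_closedBall 0 Q).inter_right (isClosed_le continuous_im continuous_const)
    obtain ⟨a, ha, hac⟩ := hcomp.exists_mapClusterPt_of_frequently hf
    have ha2 : a.im ≤ -ε := ha.2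
    exact hex a (by linarith) hac

lemma stieltjes_side (ρ : Measure ℝ) [IsProbabilityMeasure ρ] (φ : ℝ → ℝ) (hφ : Continuous φ)
    (hφc : HasCompactSupport φ) :
    Tendsto (fun y : ℝ => ∫ x : ℝ, φ x * ∫ t, y / ((x - t) ^ 2 + y ^ 2) ∂ρ) (𝓝[>] 0)
      (𝓝 (Real.pi * ∫ t, φ t ∂ρ)) := by
  obtain ⟨B, hB⟩ := hφc.exists_bound_of_continuous hφ
  have hφi : Integrable φ := hφ.integrable_of_hasCompactSupport hφc
  have hdom : Integrable (fun p : ℝ × ℝ => B * (1 + p.2 ^ 2)⁻¹) (ρ.prod volume) :=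
    (integrable_inv_one_add_sq.comp_snd ρ).const_mul B
  have hbd : ∀ y : ℝ, ∀ p : ℝ × ℝ, ‖φ (p.1 + y * p.2) * (1 + p.2 ^ 2)⁻¹‖ ≤ B * (1 + p.2 ^ 2)⁻¹ := by
    intro y p
    have h0 : 0 ≤ (1 + p.2 ^ 2)⁻¹ := by positivity
    rw [norm_mul, Real.norm_of_nonneg h0]
    exact mul_le_mul_of_nonneg_right (hB _) h0
  have hmeas : ∀ y : ℝ, AEStronglyMeasurable
      (fun p : ℝ × ℝ => φ (p.1 + y * p.2) * (1 + p.2 ^ 2)⁻¹) (ρ.prod volume) := by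
    intro y
    refine Continuous.aestronglyMeasurable ?_
    refine Continuous.mul (by fun_prop) (Continuous.inv₀ (by fun_prop) fun p => ?_)
    positivity
  have hintg : ∀ y : ℝ, Integrable
      (fun p : ℝ × ℝ => φ (p.1 + y * p.2) * (1 + p.2 ^ 2)⁻¹) (ρ.prod volume) := fun y =>
    hdom.mono' (hmeas y) (Eventually.of_forall (hbd y))
  have hlim : Tendsto (fun y : ℝ => ∫ p : ℝ × ℝ, φ (p.1 + y * p.2) * (1 + p.2 ^ 2)⁻¹ ∂(ρ.prod volume))
      (𝓝[>] 0) (𝓝 (∫ p : ℝ × ℝ, φ (p.1 + 0 * p.2) * (1 + p.2 ^ 2)⁻¹ ∂(ρ.prod volume))) := by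
    refine tendsto_integral_filter_of_dominated_convergence _ (Eventually.of_forall hmeas)
      (Eventually.of_forall fun y => Eventually.of_forall (hbd y)) hdom (Eventually.of_forall ?_)
    intro p
    have : Continuous fun y : ℝ => φ (p.1 + y * p.2) * (1 + p.2 ^ 2)⁻¹ := by fun_prop
    exact (this.tendsto 0).mono_left nhdsWithin_le_nhds
  have e0 : ∫ p : ℝ × ℝ, φ (p.1 + 0 * p.2) * (1 + p.2 ^ 2)⁻¹ ∂(ρ.prod volume)
      = Real.pi * ∫ t, φ t ∂ρ := by
    simp only [zero_mul, add_zero]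
    rw [integral_prod_mul φ (fun u : ℝ => (1 + u ^ 2)⁻¹), integral_univ_inv_one_add_sq, mul_comm]
  rw [e0] at hlim
  refine hlim.congr' ?_
  filter_upwards [self_mem_nhdsWithin] with y hy
  have hy0 : 0 < y := hy
  rw [integral_prod _ (hintg y)]
  have hsub : ∀ t : ℝ, ∫ u : ℝ, φ (t + y * u) * (1 + u ^ 2)⁻¹ =
      ∫ x : ℝ, φ x * (y / ((x - t) ^ 2 + y ^ 2)) := by
    intro t
    rw [← integral_add_left_eq_self (fun x : ℝ => φ x * (y / ((x - t) ^ 2 + y ^ 2))) t]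
    have := Measure.integral_comp_mul_left
      (fun x : ℝ => φ (t + x) * (y / ((t + x - t) ^ 2 + y ^ 2))) y
    rw [abs_of_pos (inv_pos.2 hy0), smul_eq_mul] at this
    have h2 : ∫ x : ℝ, φ (t + x) * (y / ((t + x - t) ^ 2 + y ^ 2)) =
        y * ∫ x : ℝ, φ (t + y * x) * (y / ((t + y * x - t) ^ 2 + y ^ 2)) := by
      rw [this, mul_inv_cancel_left₀ hy0.ne']
    rw [h2, ← integral_const_mul]
    congr 1
    ext u
    have h3 : 1 + u ^ 2 ≠ 0 := by positivity
    have h4 : (t + y * u - t) ^ 2 + y ^ 2 = y ^ 2 * (1 + u ^ 2) := by ring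
    rw [h4]
    field_simp
  simp only [hsub]
  have hint2 : Integrable (Function.uncurry fun (t x : ℝ) => φ x * (y / ((x - t) ^ 2 + y ^ 2)))
      (ρ.prod volume) := by
    refine ((hφi.comp_snd ρ).norm.mul_const (1 / y)).mono' ?_ (Eventually.of_forall ?_)
    · refine Continuous.aestronglyMeasurable ?_
      refine Continuous.mul (by fun_prop) (Continuous.div (by fun_prop) (by fun_prop) fun p => ?_)
      positivity
    · rintro ⟨t, x⟩
      simp only [Function.uncurry]
      rw [norm_mul]
      refine mul_le_mul_of_nonneg_left ?_ (norm_nonneg _)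
      rw [Real.norm_of_nonneg (by positivity), div_le_div_iff₀ (by positivity) hy0]
      nlinarith [sq_nonneg (x - t)]
  rw [integral_integral_swap hint2]
  simp only [integral_const_mul]

lemma stieltjes (ρ : Measure ℝ) [IsProbabilityMeasure ρ] (F : ℂ → ℝ)
    (hF : ContinuousOn F {w : ℂ | 0 ≤ w.im})
    (h : ∀ x y : ℝ, 0 < y → F (x + y * I) = ∫ t, y / ((x - t) ^ 2 + y ^ 2) ∂ρ) :
    Continuous (fun x : ℝ => F x / Real.pi) ∧
      ρ = volume.withDensity (fun x : ℝ => ENNReal.ofReal (F x / Real.pi)) := by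
  have hline : ∀ y : ℝ, 0 ≤ y → Continuous fun x : ℝ => F (x + y * I) := by
    intro y hy
    refine hF.comp_continuous (by fun_prop) fun x => ?_
    simpa using hy
  have hc0 : Continuous (fun x : ℝ => F x) := by simpa using hline 0 le_rfl
  have hc : Continuous (fun x : ℝ => F x / Real.pi) := hc0.div_const _
  have hvert : ∀ x : ℝ, Tendsto (fun y : ℝ => F (x + y * I)) (𝓝[>] 0) (𝓝 (F x)) := by
    intro x
    have h1 : ContinuousOn (fun y : ℝ => F (x + y * I)) (Ici 0) := by
      refine hF.comp (f := fun y : ℝ => (x : ℂ) + y * I) (by fun_prop) fun y hy => ?_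
      simpa using hy
    have h2 := (h1 0 (by simp)).tendsto.mono_left (nhdsWithin_mono _ Ioi_subset_Ici_self)
    simpa using h2
  have hnn : ∀ x : ℝ, 0 ≤ F x := by
    intro x
    refine ge_of_tendsto (hvert x) ?_
    filter_upwards [self_mem_nhdsWithin] with y hy
    have hy0 : 0 < y := hy
    rw [h x y hy0]
    exact integral_nonneg fun t => by positivity
  refine ⟨hc, ?_⟩
  have : IsLocallyFiniteMeasure (volume.withDensity (fun x : ℝ => ENNReal.ofReal (F x / Real.pi))) :=
    IsLocallyFiniteMeasure.withDensity_ofReal hc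
  refine Measure.ext_of_integral_eq_on_compactlySupported fun φ => ?_
  have hφ : Continuous φ := φ.continuous
  have hφc : HasCompactSupport φ := φ.hasCompactSupport
  have hφi : Integrable φ := hφ.integrable_of_hasCompactSupport hφc
  have hA := stieltjes_side ρ φ hφ hφc
  have hcomp : IsCompact (Set.image (fun p : ℝ × ℝ => (p.1 : ℂ) + p.2 * I) (tsupport φ ×ˢ Icc (0 : ℝ) 1)) :=
    (IsCompact.prod hφc isCompact_Icc).image (by fun_prop)
  obtain ⟨M, hM⟩ := hcomp.exists_bound_of_continuousOn (f := F) (hF.mono (by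
    rintro _ ⟨⟨x, y⟩, ⟨_, hy⟩, rfl⟩
    simpa using hy.1))
  have hBl : Tendsto (fun y : ℝ => ∫ x : ℝ, φ x * F (x + y * I)) (𝓝[>] 0) (𝓝 (∫ x : ℝ, φ x * F x)) := by
    have hsmall : ∀ᶠ y : ℝ in 𝓝[>] 0, y ∈ Ioc (0 : ℝ) 1 := Ioc_mem_nhdsGT one_pos
    refine tendsto_integral_filter_of_dominated_convergence (fun x => ‖φ x‖ * M) ?_ ?_
      (hφi.norm.mul_const M) (Eventually.of_forall fun x => (hvert x).const_mul (φ x))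
    · filter_upwards [hsmall] with y hy
      exact (hφ.mul (hline y hy.1.le)).aestronglyMeasurable
    · filter_upwards [hsmall] with y hy
      refine Eventually.of_forall fun x => ?_
      rw [norm_mul]
      by_cases hx : x ∈ tsupport φ
      · exact mul_le_mul_of_nonneg_left (hM _ ⟨(x, y), ⟨hx, hy.1.le, hy.2⟩, rfl⟩) (norm_nonneg _)
      · rw [image_eq_zero_of_notMem_tsupport hx]; simp
  have hA' : Tendsto (fun y : ℝ => ∫ x : ℝ, φ x * F (x + y * I)) (𝓝[>] 0)
      (𝓝 (Real.pi * ∫ t, φ t ∂ρ)) := by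
    refine hA.congr' ?_
    filter_upwards [self_mem_nhdsWithin] with y hy
    have hy0 : 0 < y := hy
    congr 1
    ext x
    rw [h x y hy0]
  have hE := tendsto_nhds_unique hA' hBl
  rw [integral_withDensity_eq_integral_toReal_smul hc.measurable.ennreal_ofReal (by simp)]
  have e : ∀ x : ℝ, (ENNReal.ofReal (F x / Real.pi)).toReal • φ x = Real.pi⁻¹ * (φ x * F x) := by
    intro x
    rw [ENNReal.toReal_ofReal (div_nonneg (hnn x) Real.pi_pos.le), smul_eq_mul]
    ring
  simp only [e]
  rw [integral_const_mul, ← hE]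
  have := Real.pi_pos
  field_simp

lemma gr_eq (ρ : Measure ℝ) [IsProbabilityMeasure ρ]
    (hρsym : Measure.map (fun t : ℝ => -t) ρ = ρ) {x y : ℝ} (hy : 0 < y) :
    -(gr ρ (x + y * I)).im = ∫ t, y / ((x - t) ^ 2 + y ^ 2) ∂ρ := by
  have hpos : ∀ s : ℝ, 0 < s ^ 2 + y ^ 2 := fun s => by positivity
  have hb : ∀ s : ℝ, y / (s ^ 2 + y ^ 2) ≤ 1 / y := fun s => by
    rw [div_le_div_iff₀ (hpos s) hy]; nlinarith [sq_nonneg s]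
  have hi1 : Integrable (fun t => y / ((x - t) ^ 2 + y ^ 2)) ρ := by
    refine (integrable_const (1 / y)).mono' ?_ (Eventually.of_forall fun t => ?_)
    · exact (Continuous.div (by fun_prop) (by fun_prop) fun t => (hpos _).ne').aestronglyMeasurable
    · rw [Real.norm_of_nonneg (div_nonneg hy.le (hpos _).le)]; exact hb _
  have hi2 : Integrable (fun t => y / ((x + t) ^ 2 + y ^ 2)) ρ := by
    refine (integrable_const (1 / y)).mono' ?_ (Eventually.of_forall fun t => ?_)
    · exact (Continuous.div (by fun_prop) (by fun_prop) fun t => (hpos _).ne').aestronglyMeasurable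
    · rw [Real.norm_of_nonneg (div_nonneg hy.le (hpos _).le)]; exact hb _
  have hsym : ∫ t, y / ((x + t) ^ 2 + y ^ 2) ∂ρ = ∫ t, y / ((x - t) ^ 2 + y ^ 2) ∂ρ := by
    conv_rhs => rw [← hρsym]
    have hcn : Continuous fun t : ℝ => y / ((x - t) ^ 2 + y ^ 2) :=
      Continuous.div (by fun_prop) (by fun_prop) fun t => (hpos _).ne'
    have hmap := integral_map (μ := ρ) (φ := fun t : ℝ => -t)
      (f := fun t : ℝ => y / ((x - t) ^ 2 + y ^ 2)) (by fun_prop) hcn.aestronglyMeasurable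
    rw [hmap]
    simp only [sub_neg_eq_add]
  obtain ⟨w, hwd⟩ : ∃ w : ℂ, w = x + y * I := ⟨_, rfl⟩
  have hwim : 0 < w.im := by rw [hwd]; simpa using hy
  have him : ∀ s : ℝ, (1 / (w - s)).im = -(y / ((x - s) ^ 2 + y ^ 2)) := by
    intro s
    rw [one_div, inv_im, normSq_apply, hwd]
    simp
    ring
  have hne : ∀ s : ℝ, w - s ≠ 0 := fun s => im_ne (by simpa using hwim)
  rw [← hwd]
  have hpt : ∀ t : ℝ, (w * (1 / (w * w - (t : ℂ) ^ 2))).im =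
      -(y / ((x - t) ^ 2 + y ^ 2) + y / ((x + t) ^ 2 + y ^ 2)) / 2 := by
    intro t
    have h1 := hne t
    have h2 := hne (-t)
    have e : w * (1 / (w * w - (t : ℂ) ^ 2)) = ((1 / 2 : ℝ) : ℂ) * (1 / (w - t) + 1 / (w - (-t : ℝ))) := by
      have e2 : w * w - (t : ℂ) ^ 2 = (w - t) * (w - (-t : ℝ)) := by push_cast; ring
      rw [e2]
      field_simp
      push_cast
      ring
    rw [e, im_ofReal_mul, add_im, him, him]
    rw [sub_neg_eq_add]; ring
  have hs : -(w * w) ∈ slitPlane := slit_mul' hwim hwim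
  have hintg : Integrable (fun t : ℝ => w * (1 / (w * w - (t : ℂ) ^ 2))) ρ :=
    (Dm_integrable ρ hs).const_mul w
  have : (gr ρ w).im = ∫ t : ℝ, (w * (1 / (w * w - (t : ℂ) ^ 2))).im ∂ρ := by
    rw [gr, Dm, ← integral_const_mul]
    exact (Complex.imCLM.integral_comp_comm hintg).symm
  rw [this]
  simp only [hpt]
  rw [integral_div, integral_neg, integral_add hi1 hi2, hsym]
  ring

lemma lim_all {l : ℝ} (hl : l ∈ Set.Ioo (0 : ℝ) 1) (G ν ρ : Measure ℝ) [IsFiniteMeasure G]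
    [IsProbabilityMeasure ν] [IsProbabilityMeasure ρ] (hconv : IsRectConv l G ν ρ)
    (hC2 : ∃ L : EReal, L ≤ 0 ∧ L ≠ 0 ∧
      Tendsto (fun x : ℝ => (((rectC G (x : ℂ)) ^ 2 / (x : ℂ)).re : EReal)) atBot
        (nhds L)) (w0 : ℂ) (hw : 0 ≤ w0.im) :
    ∃ c : ℝ, Tendsto (fun w => -(gr ρ w).im) (𝓝[{w : ℂ | 0 < w.im}] w0) (𝓝 c) := by
  have hG : G ≠ 0 := by
    rintro rfl
    obtain ⟨R, _, h⟩ := cneg_large 0 hC2 0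
    have := h (R + 1) (by linarith)
    simp [cneg] at this
  obtain ⟨R, hR, hRb⟩ := cneg_large G hC2 ((1 + 1 / l) / 2)
  have hP := Phi_gr hl G ν ρ hG hconv
  suffices h : ∃ c : ℝ, Tendsto (fun w => (gr ρ w).im) (𝓝[{w : ℂ | 0 < w.im}] w0) (𝓝 c) by
    obtain ⟨c, hc⟩ := h
    exact ⟨-c, hc.neg⟩
  by_cases hw0 : w0 = 0
  · subst hw0
    exact ⟨0, lim_zero hl ρ hR fun w hw => h_bd hl G ν ρ hG hRb hP hw⟩
  · exact lim_ne hl G ν ρ hG hR hRb hP hw hw0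

theorem stmt17 (l : ℝ) (hl : l ∈ Set.Ioo (0 : ℝ) 1)
    (μ : Measure ℝ) [IsProbabilityMeasure μ] (hμ0 : μ ≠ Measure.dirac (0 : ℝ))
    (hμsym : Measure.map (fun t : ℝ => -t) μ = μ)
    (G : Measure ℝ) [IsFiniteMeasure G]
    (hGsym : Measure.map (fun t : ℝ => -t) G = G)
    (hID : IsRectInfDiv l μ G)
    (ν ρ : Measure ℝ) [IsProbabilityMeasure ν] [IsProbabilityMeasure ρ]
    (hνsym : Measure.map (fun t : ℝ => -t) ν = ν)
    (hρsym : Measure.map (fun t : ℝ => -t) ρ = ρ)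
    (hconv : IsRectConv l G ν ρ)
    (hC2 : ∃ L : EReal, L ≤ 0 ∧ L ≠ 0 ∧
      Tendsto (fun x : ℝ => (((rectC G (x : ℂ)) ^ 2 / (x : ℂ)).re : EReal)) atBot
        (nhds L)) :
    ∃ f : ℝ → ℝ, Continuous f ∧
      ρ = volume.withDensity (fun x => ENNReal.ofReal (f x)) := by
  have hopen : IsOpen {w : ℂ | 0 < w.im} := isOpen_lt continuous_const continuous_im
  have hsub : {w : ℂ | 0 ≤ w.im} ⊆ closure {w : ℂ | 0 < w.im} := by
    rw [Complex.closure_setOfPred_lt_im]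
  have hF := continuousOn_extendFrom hsub (lim_all hl G ν ρ hconv hC2)
  refine ⟨_, stieltjes ρ (extendFrom {w : ℂ | 0 < w.im} fun w => -(gr ρ w).im) hF ?_⟩
  intro x y hy
  have hm : ((x : ℂ) + y * I) ∈ {w : ℂ | 0 < w.im} := by simpa using hy
  have ht : Tendsto (fun w => -(gr ρ w).im) (𝓝[{w : ℂ | 0 < w.im}] ((x : ℂ) + y * I))
      (𝓝 (-(gr ρ ((x : ℂ) + y * I)).im)) :=
    (continuous_im.continuousAt.comp (gr_diff ρ hm).continuousAt).neg.tendsto.mono_left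
      nhdsWithin_le_nhds
  rw [extendFrom_eq (subset_closure hm) ht]
  exact gr_eq ρ hρsym hy

end
end
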